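/- arXiv:1710.02335 — 3 statements merged into one kernel-verified Lean document; each statement's English description precedes it below -/
import Mathlib

section
/- Let n ≥ 2 and let Γₙ = ℤⁿ ⋊ ℤ/2ℤ, where the nontrivial element of ℤ/2ℤ acts on ℤⁿ by x ↦ −x. Let φ be an automorphism of Γₙ. Then there exist a matrix D ∈ GLₙ(ℤ) and a vector d ∈ ℤⁿ such that φ(x, 0̄) = (Dx, 0̄) for all x ∈ ℤⁿ and φ(0, 1̄) = (d, 1̄); moreover, if the Reidemeister number R(φ) is finite, then R(φ) = (|det(Iₙ − D)| + |det(Iₙ + D)|)/2 + O(Iₙ − D, d). -/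
open Matrix


/-- Twisted conjugacy relation. -/
def twistedConj {G : Type*} [Group G] (φ : G →* G) (g g' : G) : Prop :=
  ∃ h : G, g = h * g' * (φ h)⁻¹

/-- Reidemeister number: number of twisted conjugacy classes (0 if infinite). -/
noncomputable def reidemeisterNumber {G : Type*} [Group G] (φ : G →* G) : ℕ :=
  Nat.card (Quot (twistedConj φ))

/-- ℤⁿ written multiplicatively. -/
abbrev Znm (n : ℕ) := Multiplicative (Fin n → ℤ)

/-- The negation automorphism of ℤⁿ. -/
def negAut (n : ℕ) : MulAut (Znm n) := MulEquiv.inv (Znm n)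

/-- The action of ℤ/2ℤ on ℤⁿ where the nontrivial element acts by negation. -/
def negAct (n : ℕ) : Multiplicative (ZMod 2) →* MulAut (Znm n) :=
  MonoidHom.mk' (fun a => negAut n ^ (a.toAdd).val) (by
    have key : negAut n * negAut n = 1 := by
      ext x
      simp [negAut]
    have h2 : ∀ x : ZMod 2, x = 0 ∨ x = 1 := by decide
    intro a b
    rcases h2 a.toAdd with ha | ha <;> rcases h2 b.toAdd with hb | hb <;>
      simp only [toAdd_mul, ha, hb] <;>
      norm_num [show (ZMod.val (2 : ZMod 2)) = 0 from rfl, show (ZMod.val (1 : ZMod 2)) = 1 from rfl,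
        show (ZMod.val (0 : ZMod 2)) = 0 from rfl, show ((0+1 : ZMod 2)).val = 1 from rfl,
        show ((1+0 : ZMod 2)).val = 1 from rfl, pow_succ, key])

/-- The crystallographic group ℤⁿ ⋊ ℤ/2ℤ. -/
abbrev Gamma (n : ℕ) := SemidirectProduct (Znm n) (Multiplicative (ZMod 2)) (negAct n)

/-- `solCount A a` : the number of solutions `x` over `ℤ/2ℤ` of the linear system
`Ā x = ā`, where `Ā`, `ā` are the mod 2 reductions of `A` and `a`. -/
noncomputable def solCount {n : ℕ} (A : Matrix (Fin n) (Fin n) ℤ) (a : Fin n → ℤ) : ℕ :=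
  Nat.card {x : Fin n → ZMod 2 //
    (A.map (Int.cast : ℤ → ZMod 2)).mulVec x = fun i => ((a i : ZMod 2))}

def dbl {n : ℕ} (A : Matrix (Fin n) (Fin n) ℤ) (c : Fin n → ℤ) (x y : Fin n → ℤ) : Prop :=
  ∃ h : Fin n → ℤ, x = y + A.mulVec h ∨ x = A.mulVec h - y + c

/-- translation element -/
def tr {n : ℕ} (x : Fin n → ℤ) : Gamma n := ⟨Multiplicative.ofAdd x, 1⟩
/-- reflection element -/
def rf {n : ℕ} (x : Fin n → ℤ) : Gamma n := ⟨Multiplicative.ofAdd x, Multiplicative.ofAdd 1⟩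

theorem negAct_one' (n : ℕ) (x : Znm n) : negAct n (Multiplicative.ofAdd 1) x = x⁻¹ := by
  change (negAut n ^ (1 : ZMod 2).val) x = _
  rw [show (1 : ZMod 2).val = 1 from rfl, pow_one]; rfl

theorem gamma_cases {n : ℕ} (g : Gamma n) : (∃ x, g = tr x) ∨ (∃ x, g = rf x) := by
  obtain ⟨a, t⟩ := g
  have h2 : ∀ x : Multiplicative (ZMod 2), x = 1 ∨ x = Multiplicative.ofAdd 1 := by decide
  rcases h2 t with rfl | rfl
  · exact Or.inl ⟨a.toAdd, rfl⟩
  · exact Or.inr ⟨a.toAdd, rfl⟩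

theorem tr_mul_tr {n : ℕ} (x y : Fin n → ℤ) : tr x * tr y = tr (x + y) := by
  ext1 <;> simp [tr]
theorem tr_mul_rf {n : ℕ} (x y : Fin n → ℤ) : tr x * rf y = rf (x + y) := by
  ext1 <;> simp [tr, rf]
theorem rf_mul_tr {n : ℕ} (x y : Fin n → ℤ) : rf x * tr y = rf (x - y) := by
  ext1 <;> simp [tr, rf, negAct_one', sub_eq_add_neg]
theorem rf_mul_rf {n : ℕ} (x y : Fin n → ℤ) : rf x * rf y = tr (x - y) := by
  ext1
  · simp [tr, rf, negAct_one', sub_eq_add_neg]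
  · change Multiplicative.ofAdd (1 : ZMod 2) * Multiplicative.ofAdd 1 = 1
    decide
theorem tr_zero {n : ℕ} : tr (0 : Fin n → ℤ) = 1 := rfl
theorem tr_inv {n : ℕ} (x : Fin n → ℤ) : (tr x)⁻¹ = tr (-x) := by
  rw [inv_eq_iff_mul_eq_one, tr_mul_tr, add_neg_cancel, tr_zero]
theorem rf_inv {n : ℕ} (x : Fin n → ℤ) : (rf x)⁻¹ = rf x := by
  rw [inv_eq_iff_mul_eq_one, rf_mul_rf, sub_self, tr_zero]
theorem tr_inj {n : ℕ} {x y : Fin n → ℤ} : tr x = tr y ↔ x = y :=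
  ⟨fun h => congrArg (fun g : Gamma n => g.left.toAdd) h, fun h => by rw [h]⟩
theorem rf_inj {n : ℕ} {x y : Fin n → ℤ} : rf x = rf y ↔ x = y :=
  ⟨fun h => congrArg (fun g : Gamma n => g.left.toAdd) h, fun h => by rw [h]⟩
theorem tr_ne_rf {n : ℕ} {x y : Fin n → ℤ} : tr x ≠ rf y := fun h => by
  have := congrArg (fun g : Gamma n => g.right) h
  change (1 : Multiplicative (ZMod 2)) = Multiplicative.ofAdd 1 at this
  revert this
  decide

theorem map_tr {n : ℕ} (φ : Gamma n ≃* Gamma n) (x : Fin n → ℤ) : ∃ y, φ (tr x) = tr y := by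
  rcases gamma_cases (φ (tr x)) with h | ⟨y, h⟩
  · exact h
  · exfalso
    have h1 : φ (tr (x + x)) = φ 1 := by rw [← tr_mul_tr, map_mul, h, rf_mul_rf, sub_self, tr_zero, map_one]
    have h2 := φ.injective h1
    rw [← tr_zero, tr_inj] at h2
    have h3 : x = 0 := by
      ext i; have := congrFun h2 i; simp at this; simpa using this
    rw [h3, tr_zero, map_one, ← tr_zero] at h
    exact tr_ne_rf h

theorem map_rf {n : ℕ} (φ : Gamma n ≃* Gamma n) (x : Fin n → ℤ) : ∃ y, φ (rf x) = rf y := by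
  rcases gamma_cases (φ (rf x)) with ⟨y, h⟩ | h
  · exfalso
    obtain ⟨z, hz⟩ := map_tr φ.symm y
    rw [← h, MulEquiv.symm_apply_apply] at hz
    exact tr_ne_rf hz.symm
  · exact h

theorem exists_mat {n : ℕ} (φ : Gamma n ≃* Gamma n) :
    ∃ D : Matrix (Fin n) (Fin n) ℤ, ∀ x, φ (tr x) = tr (D.mulVec x) := by
  choose f hf using map_tr φ
  have hadd : ∀ x y, f (x + y) = f x + f y := fun x y => by
    rw [← tr_inj, ← hf, ← tr_mul_tr, map_mul, hf, hf, tr_mul_tr]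
  let L : (Fin n → ℤ) →ₗ[ℤ] (Fin n → ℤ) := (AddMonoidHom.mk' f hadd).toIntLinearMap
  refine ⟨LinearMap.toMatrix' L, fun x => ?_⟩
  rw [LinearMap.toMatrix'_mulVec, hf]; rfl

theorem mat_isUnit {n : ℕ} (φ : Gamma n ≃* Gamma n) (D : Matrix (Fin n) (Fin n) ℤ)
    (hD : ∀ x, φ (tr x) = tr (D.mulVec x)) : IsUnit D := by
  obtain ⟨E, hE⟩ := exists_mat φ.symm
  have : E * D = 1 := by
    apply Matrix.ext_of_mulVec_single
    intro i
    rw [← Matrix.mulVec_mulVec, Matrix.one_mulVec, ← tr_inj, ← hE, ← hD, MulEquiv.symm_apply_apply]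
  exact IsUnit.of_mul_eq_one_right E this

theorem twisted_equiv {n : ℕ} (φ : Gamma n ≃* Gamma n) (D : Matrix (Fin n) (Fin n) ℤ)
    (d : Fin n → ℤ) (hD : ∀ x, φ (tr x) = tr (D.mulVec x)) (hd : φ (rf 0) = rf d) :
    Nonempty (Quot (twistedConj φ.toMonoidHom) ≃ Quot (dbl (1 - D) (-d)) ⊕ Quot (dbl (1 + D) d)) := by
  have hr : ∀ x, φ (rf x) = rf (D.mulVec x + d) := fun x => by
    rw [show rf x = tr x * rf 0 by rw [tr_mul_rf, add_zero], map_mul, hD, hd, tr_mul_rf]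
  have c1 : ∀ x y, twistedConj φ.toMonoidHom (tr x) (tr y) ↔ dbl (1 - D) (-d) x y := by
    intro x y
    constructor
    · rintro ⟨h, hh⟩
      rcases gamma_cases h with ⟨z, rfl⟩ | ⟨z, rfl⟩ <;> refine ⟨z, ?_⟩
      · left
        simp only [MulEquiv.toMonoidHom_eq_coe, MonoidHom.coe_coe, hD, tr_inv, tr_mul_tr, tr_inj] at hh
        rw [hh, Matrix.sub_mulVec, Matrix.one_mulVec]; abel
      · right
        simp only [MulEquiv.toMonoidHom_eq_coe, MonoidHom.coe_coe, hr, rf_inv, rf_mul_tr, rf_mul_rf, tr_inj] at hh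
        rw [hh, Matrix.sub_mulVec, Matrix.one_mulVec]; abel
    · rintro ⟨z, hz | hz⟩
      · refine ⟨tr z, ?_⟩
        simp only [MulEquiv.toMonoidHom_eq_coe, MonoidHom.coe_coe, hD, tr_inv, tr_mul_tr, tr_inj]
        rw [hz, Matrix.sub_mulVec, Matrix.one_mulVec]; abel
      · refine ⟨rf z, ?_⟩
        simp only [MulEquiv.toMonoidHom_eq_coe, MonoidHom.coe_coe, hr, rf_inv, rf_mul_tr, rf_mul_rf, tr_inj]
        rw [hz, Matrix.sub_mulVec, Matrix.one_mulVec]; abel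
  have c2 : ∀ x y, twistedConj φ.toMonoidHom (rf x) (rf y) ↔ dbl (1 + D) d x y := by
    intro x y
    constructor
    · rintro ⟨h, hh⟩
      rcases gamma_cases h with ⟨z, rfl⟩ | ⟨z, rfl⟩ <;> refine ⟨z, ?_⟩
      · left
        simp only [MulEquiv.toMonoidHom_eq_coe, MonoidHom.coe_coe, hD, tr_inv, tr_mul_rf, rf_mul_tr, rf_inj] at hh
        rw [hh, Matrix.add_mulVec, Matrix.one_mulVec]; abel
      · right
        simp only [MulEquiv.toMonoidHom_eq_coe, MonoidHom.coe_coe, hr, rf_inv, tr_mul_rf, rf_mul_rf, rf_inj] at hh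
        rw [hh, Matrix.add_mulVec, Matrix.one_mulVec]; abel
    · rintro ⟨z, hz | hz⟩
      · refine ⟨tr z, ?_⟩
        simp only [MulEquiv.toMonoidHom_eq_coe, MonoidHom.coe_coe, hD, tr_inv, tr_mul_rf, rf_mul_tr, rf_inj]
        rw [hz, Matrix.add_mulVec, Matrix.one_mulVec]; abel
      · refine ⟨rf z, ?_⟩
        simp only [MulEquiv.toMonoidHom_eq_coe, MonoidHom.coe_coe, hr, rf_inv, tr_mul_rf, rf_mul_rf, rf_inj]
        rw [hz, Matrix.add_mulVec, Matrix.one_mulVec]; abel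
  have c3 : ∀ x y, ¬ twistedConj φ.toMonoidHom (tr x) (rf y) := by
    rintro x y ⟨h, hh⟩
    rcases gamma_cases h with ⟨z, rfl⟩ | ⟨z, rfl⟩ <;>
    simp only [MulEquiv.toMonoidHom_eq_coe, MonoidHom.coe_coe, hD, hr, tr_inv, rf_inv, tr_mul_rf, rf_mul_tr, tr_mul_tr, rf_mul_rf] at hh <;>
    exact tr_ne_rf hh
  have c4 : ∀ x y, ¬ twistedConj φ.toMonoidHom (rf x) (tr y) := by
    rintro x y ⟨h, hh⟩
    rcases gamma_cases h with ⟨z, rfl⟩ | ⟨z, rfl⟩ <;>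
    simp only [MulEquiv.toMonoidHom_eq_coe, MonoidHom.coe_coe, hD, hr, tr_inv, rf_inv, tr_mul_rf, rf_mul_tr, tr_mul_tr, rf_mul_rf] at hh <;>
    exact tr_ne_rf hh.symm
  let F : Gamma n → Quot (dbl (1 - D) (-d)) ⊕ Quot (dbl (1 + D) d) := fun g =>
    if g.right = 1 then Sum.inl (Quot.mk _ g.left.toAdd) else Sum.inr (Quot.mk _ g.left.toAdd)
  have F1 : ∀ x, F (tr x) = Sum.inl (Quot.mk _ x) := fun x => if_pos rfl
  have F2 : ∀ x, F (rf x) = Sum.inr (Quot.mk _ x) := fun x => if_neg (by change ¬ (Multiplicative.ofAdd (1 : ZMod 2) = 1); decide)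
  have hF : ∀ g g', twistedConj φ.toMonoidHom g g' → F g = F g' := by
    intro g g' h
    rcases gamma_cases g with ⟨x, rfl⟩ | ⟨x, rfl⟩ <;> rcases gamma_cases g' with ⟨y, rfl⟩ | ⟨y, rfl⟩
    · rw [F1, F1, Quot.sound ((c1 x y).1 h)]
    · exact (c3 _ _ h).elim
    · exact (c4 _ _ h).elim
    · rw [F2, F2, Quot.sound ((c2 x y).1 h)]
  refine ⟨⟨Quot.lift F hF, Sum.elim (Quot.map tr fun x y h => (c1 x y).2 h) (Quot.map rf fun x y h => (c2 x y).2 h), ?_, ?_⟩⟩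
  · rintro ⟨g⟩
    rcases gamma_cases g with ⟨x, rfl⟩ | ⟨x, rfl⟩
    · change Sum.elim _ _ (F (tr x)) = _
      rw [F1]; rfl
    · change Sum.elim _ _ (F (rf x)) = _
      rw [F2]; rfl
  · rintro (q | q)
    · obtain ⟨x, rfl⟩ := Quot.exists_rep q
      exact F1 x
    · obtain ⟨x, rfl⟩ := Quot.exists_rep q
      exact F2 x

theorem orbit_count {C : Type*} [Finite C] (s : C → C) (hs : ∀ x, s (s x) = x) :
    2 * Nat.card (Quot (fun x y : C => x = y ∨ x = s y)) = Nat.card C + Nat.card {x // s x = x} := by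
  classical
  have := Fintype.ofFinite C
  let r : C → C → Prop := fun x y : C => x = y ∨ x = s y
  have he : Equivalence r := by
    refine ⟨fun x => Or.inl rfl, ?_, ?_⟩
    · rintro x y (h | h)
      · exact Or.inl h.symm
      · right; rw [h, hs]
    · rintro x y z (rfl | rfl) (rfl | rfl)
      · exact Or.inl rfl
      · exact Or.inr rfl
      · exact Or.inr rfl
      · left; rw [hs]
  have := Fintype.ofFinite (Quot r)
  have hmk : ∀ x y, Quot.mk r x = Quot.mk r y ↔ r x y := fun x y =>
    ⟨fun h => he.eqvGen_iff.1 (Quot.eqvGen_exact h), Quot.sound⟩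
  have e1 := Finset.card_eq_sum_card_fiberwise (f := Quot.mk r) (s := Finset.univ) (t := Finset.univ) (by simp)
  have e2 := Finset.card_eq_sum_card_fiberwise (f := Quot.mk r) (s := Finset.univ.filter fun x => s x = x) (t := Finset.univ) (by simp)
  rw [show Nat.card {x // s x = x} = (Finset.univ.filter fun x => s x = x).card by
    rw [Nat.card_eq_fintype_card, Fintype.card_subtype], Nat.card_eq_fintype_card, Nat.card_eq_fintype_card, ← Finset.card_univ, ← Finset.card_univ, e1, e2, ← Finset.sum_add_distrib, mul_comm]
  symm
  rw [← smul_eq_mul, ← Finset.sum_const]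
  apply Finset.sum_congr rfl
  intro q _
  induction q using Quot.ind with | mk x => ?_
  have f1 : (Finset.univ.filter fun a => Quot.mk r a = Quot.mk r x) = {x, s x} := by
    ext a; simp [hmk, r]
  rw [Finset.filter_filter]
  by_cases hx : s x = x
  · have f2 : (Finset.univ.filter fun a => s a = a ∧ Quot.mk r a = Quot.mk r x) = {x} := by
      ext a; simp only [hmk, r, Finset.mem_filter, Finset.mem_univ, true_and, Finset.mem_singleton]
      grind
    rw [f1, f2]; simp [hx]
  · have f2 : (Finset.univ.filter fun a => s a = a ∧ Quot.mk r a = Quot.mk r x) = ∅ := by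
      ext a; simp only [hmk, r, Finset.mem_filter, Finset.mem_univ, true_and, Finset.notMem_empty, iff_false]
      grind
    rw [f1, f2, Finset.card_pair (Ne.symm hx)]; simp

theorem coker_card {n : ℕ} (A : Matrix (Fin n) (Fin n) ℤ) (hA : A.det ≠ 0) :
    Nat.card ((Fin n → ℤ) ⧸ LinearMap.range A.mulVecLin) = A.det.natAbs := by
  have hinj : Function.Injective A.mulVecLin := Matrix.mulVec_injective_of_det_ne_zero hA
  have := Submodule.natAbs_det_basis_change (Pi.basisFun ℤ (Fin n)) (LinearMap.range A.mulVecLin)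
    ((Pi.basisFun ℤ (Fin n)).map (LinearEquiv.ofInjective _ hinj))
  rw [← this, Module.Basis.det_apply]
  congr 2
  ext i j
  simp [Module.Basis.toMatrix_apply]

theorem coker_infinite {n : ℕ} (A : Matrix (Fin n) (Fin n) ℤ)
    [Finite ((Fin n → ℤ) ⧸ LinearMap.range A.mulVecLin)] : A.det ≠ 0 := by
  intro hA
  obtain ⟨w, hw, hwA⟩ := Matrix.exists_vecMul_eq_zero_iff.2 hA
  obtain ⟨i, hi⟩ := Function.ne_iff.1 hw
  have : Function.Injective (fun k : ℤ =>
      (Submodule.Quotient.mk (Pi.single i k) : (Fin n → ℤ) ⧸ LinearMap.range A.mulVecLin)) := by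
    intro k l h
    rw [Submodule.Quotient.eq] at h
    obtain ⟨h, hh⟩ := h
    have h2 := congrArg (fun v => w ⬝ᵥ v) hh
    simp only [Matrix.mulVecLin_apply, Matrix.dotProduct_mulVec, hwA, zero_dotProduct,
      dotProduct_sub, dotProduct_single] at h2
    have h3 : w i * (k - l) = 0 := by rw [mul_sub]; exact h2.symm
    rcases mul_eq_zero.1 h3 with h4 | h4
    · exact (hi h4).elim
    · exact sub_eq_zero.1 h4
  exact not_injective_infinite_finite _ this

theorem fix_card {n : ℕ} (A : Matrix (Fin n) (Fin n) ℤ) (c : Fin n → ℤ) (hA : A.det ≠ 0) :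
    Nat.card {x : (Fin n → ℤ) ⧸ LinearMap.range A.mulVecLin //
      Submodule.Quotient.mk c - x = x} = solCount A c := by
  have hinj := Matrix.mulVec_injective_of_det_ne_zero hA
  symm
  have cast_mul : ∀ y : Fin n → ℤ, (A.map (Int.cast : ℤ → ZMod 2)).mulVec (fun i => (y i : ZMod 2))
      = fun i => ((A.mulVec y i : ℤ) : ZMod 2) := by
    intro y; ext i; simp [Matrix.mulVec, dotProduct]
  -- a lift with half
  have lift : ∀ y : {x : Fin n → ZMod 2 //
    (A.map (Int.cast : ℤ → ZMod 2)).mulVec x = fun i => ((c i : ZMod 2))},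
      ∃ z x : Fin n → ℤ, (∀ i, (z i : ZMod 2) = y.1 i) ∧ x + x = c + A.mulVec z := by
    rintro ⟨y, hy⟩
    choose z hz using fun i => ZMod.intCast_surjective (y i)
    have hz' : y = fun i => (z i : ZMod 2) := by ext i; rw [hz]
    have : ∀ i, ∃ t, c i + A.mulVec z i = t + t := by
      intro i
      rw [hz', cast_mul] at hy
      have h1 := congrFun hy i
      have h2 : ((c i + A.mulVec z i : ℤ) : ZMod 2) = 0 := by
        push_cast; rw [h1]; exact CharTwo.add_self_eq_zero _
      rw [ZMod.intCast_zmod_eq_zero_iff_dvd] at h2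
      obtain ⟨t, ht⟩ := h2
      exact ⟨t, by rw [ht]; push_cast; ring⟩
    choose x hx using this
    exact ⟨z, x, hz, by ext i; exact (hx i).symm⟩
  choose z x hz hx using lift
  refine Nat.card_congr (Equiv.ofBijective (fun y => ⟨Submodule.Quotient.mk (x y), ?_⟩) ⟨?_, ?_⟩)
  · rw [← Submodule.Quotient.mk_sub, Submodule.Quotient.eq]
    refine ⟨-z y, ?_⟩
    rw [Matrix.mulVecLin_apply, Matrix.mulVec_neg, sub_sub, hx]; abel
  · intro y y' h
    have h1 := congrArg Subtype.val h
    simp only [Submodule.Quotient.eq] at h1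
    obtain ⟨k, hk⟩ := h1
    rw [Matrix.mulVecLin_apply] at hk
    have h2 : A.mulVec (z y) = A.mulVec (z y' + (k + k)) := by
      rw [Matrix.mulVec_add, Matrix.mulVec_add, hk]
      have e1 := hx y
      have e2 := hx y'
      rw [← sub_eq_iff_eq_add'] at e1 e2
      rw [← e1, ← e2]; abel
    have h3 := hinj h2
    ext i
    rw [← hz, ← hz, h3]
    simp [CharTwo.add_self_eq_zero]
  · rintro ⟨q, hq⟩
    obtain ⟨u, rfl⟩ := Submodule.Quotient.mk_surjective _ q
    rw [← Submodule.Quotient.mk_sub, Submodule.Quotient.eq] at hq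
    obtain ⟨k, hk⟩ := hq
    rw [Matrix.mulVecLin_apply] at hk
    have hc : c = A.mulVec k + u + u := by rw [hk]; abel
    have hp : (A.map (Int.cast : ℤ → ZMod 2)).mulVec (fun i => (k i : ZMod 2)) = fun i => ((c i : ZMod 2)) := by
      rw [cast_mul, hc]; ext i
      simp [add_assoc, CharTwo.add_self_eq_zero]
    refine ⟨⟨fun i => (k i : ZMod 2), hp⟩, ?_⟩
    · set y : {x : Fin n → ZMod 2 // (A.map (Int.cast : ℤ → ZMod 2)).mulVec x = fun i => ((c i : ZMod 2))} := ⟨fun i => (k i : ZMod 2), hp⟩ with hy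
      have : ∀ i, ∃ t, z y i + k i = t + t := by
        intro i
        have h2 : ((z y i + k i : ℤ) : ZMod 2) = 0 := by
          push_cast; rw [hz]; exact CharTwo.add_self_eq_zero _
        rw [ZMod.intCast_zmod_eq_zero_iff_dvd] at h2
        obtain ⟨t, ht⟩ := h2
        exact ⟨t, by rw [ht]; push_cast; ring⟩
      choose t ht using this
      have ht' : z y + k = t + t := by ext i; exact ht i
      apply Subtype.ext
      change Submodule.Quotient.mk (x y) = Submodule.Quotient.mk u
      rw [Submodule.Quotient.eq]
      refine ⟨t, ?_⟩
      have h5 := hx y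
      have h6 : A.mulVec (z y) + A.mulVec k = A.mulVec t + A.mulVec t := by
        rw [← Matrix.mulVec_add, ht', Matrix.mulVec_add]
      rw [Matrix.mulVecLin_apply]
      ext i
      have a1 := congrFun h5 i
      have a2 := congrFun h6 i
      have a3 := congrFun hc i
      simp only [Pi.add_apply, Pi.sub_apply] at *
      linarith

theorem dbl_card {n : ℕ} (A : Matrix (Fin n) (Fin n) ℤ) (c : Fin n → ℤ) (hf : Finite (Quot (dbl A c))) :
    2 * Nat.card (Quot (dbl A c)) = A.det.natAbs + solCount A c := by
  let C := (Fin n → ℤ) ⧸ LinearMap.range A.mulVecLin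
  let mk : (Fin n → ℤ) → C := Submodule.Quotient.mk
  let s : C → C := fun x => mk c - x
  have hs : ∀ x, s (s x) = x := fun x => sub_sub_cancel _ _
  let r : C → C → Prop := fun x y => x = y ∨ x = s y
  have hr : ∀ x y, dbl A c x y ↔ r (mk x) (mk y) := by
    intro x y
    have h1 : mk x = mk y ↔ ∃ h, A.mulVec h = x - y := Submodule.Quotient.eq _
    have h2 : mk x = s (mk y) ↔ ∃ h, A.mulVec h = x - (c - y) := Submodule.Quotient.eq (y := c - y) _
    simp only [r]
    rw [h1, h2, dbl, exists_or]
    refine or_congr (exists_congr fun h => ?_) (exists_congr fun h => ?_)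
    · rw [eq_sub_iff_add_eq, eq_comm, add_comm]
    · rw [eq_sub_iff_add_eq, eq_comm (a := x)]
      rw [show A *ᵥ h - y + c = A *ᵥ h + (c - y) by abel]
  have e : Quot (dbl A c) ≃ Quot r := by
    refine Equiv.ofBijective (Quot.map mk fun x y h => (hr x y).1 h) ⟨?_, ?_⟩
    · rintro ⟨x⟩ ⟨y⟩ h
      have he : Equivalence r := by
        refine ⟨fun x => Or.inl rfl, ?_, ?_⟩
        · rintro x y (h | h)
          · exact Or.inl h.symm
          · right; rw [h, hs]
        · rintro x y z (rfl | rfl) (rfl | rfl)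
          · exact Or.inl rfl
          · exact Or.inr rfl
          · exact Or.inr rfl
          · left; rw [hs]
      exact Quot.sound ((hr x y).2 (he.eqvGen_iff.1 (Quot.eqvGen_exact h)))
    · rintro ⟨q⟩
      obtain ⟨x, rfl⟩ := Submodule.Quotient.mk_surjective _ q
      exact ⟨Quot.mk _ x, rfl⟩
  have hfr : Finite (Quot r) := Finite.of_equiv _ e
  have hC : Finite C := by
    have : Function.Surjective (fun p : Quot r × Bool => if p.2 then p.1.out else s p.1.out) := by
      intro x
      have he : Equivalence r := by
        refine ⟨fun x => Or.inl rfl, ?_, ?_⟩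
        · rintro x y (h | h)
          · exact Or.inl h.symm
          · right; rw [h, hs]
        · rintro x y z (rfl | rfl) (rfl | rfl)
          · exact Or.inl rfl
          · exact Or.inr rfl
          · exact Or.inr rfl
          · left; rw [hs]
      have h1 : r x (Quot.mk r x).out := he.eqvGen_iff.1 (Quot.eqvGen_exact (Quot.out_eq _).symm)
      rcases h1 with h1 | h1
      · exact ⟨(Quot.mk r x, true), h1.symm⟩
      · exact ⟨(Quot.mk r x, false), h1.symm⟩
    exact Finite.of_surjective _ this
  have hA : A.det ≠ 0 := coker_infinite A
  rw [Nat.card_congr e, orbit_count s hs, coker_card A hA, fix_card A c hA]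

theorem solCount_neg {n : ℕ} (A : Matrix (Fin n) (Fin n) ℤ) (d : Fin n → ℤ) :
    solCount A (-d) = solCount A d := by
  have : (fun i => (((-d) i : ℤ) : ZMod 2)) = fun i => ((d i : ℤ) : ZMod 2) := by
    ext i
    rw [Pi.neg_apply, Int.cast_neg, CharTwo.neg_eq]
  unfold solCount
  rw [this]

theorem solCount_add {n : ℕ} (D : Matrix (Fin n) (Fin n) ℤ) (d : Fin n → ℤ) :
    solCount (1 + D) d = solCount (1 - D) d := by
  have : (1 + D).map (Int.cast : ℤ → ZMod 2) = (1 - D).map (Int.cast : ℤ → ZMod 2) := by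
    ext i j
    simp only [Matrix.map_apply, Matrix.add_apply, Matrix.sub_apply, Int.cast_add, Int.cast_sub]
    rw [CharTwo.sub_eq_add]
  unfold solCount
  rw [this]

/-- every automorphism of `Γₙ = ℤⁿ ⋊ ℤ/2ℤ` is given by a matrix
`D ∈ GLₙ(ℤ)` and a vector `d ∈ ℤⁿ`, and if `R(φ)` is finite then
`R(φ) = (|det(I-D)| + |det(I+D)|)/2 + O(I-D, d)`. -/
theorem stmt0 (n : ℕ) (hn : 2 ≤ n) (φ : Gamma n ≃* Gamma n) :
    ∃ (D : Matrix (Fin n) (Fin n) ℤ) (d : Fin n → ℤ),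
      IsUnit D ∧
      (∀ x : Fin n → ℤ,
        φ ⟨Multiplicative.ofAdd x, 1⟩ = ⟨Multiplicative.ofAdd (D.mulVec x), 1⟩) ∧
      (φ ⟨1, Multiplicative.ofAdd 1⟩
          = ⟨Multiplicative.ofAdd d, Multiplicative.ofAdd 1⟩) ∧
      (Finite (Quot (twistedConj φ.toMonoidHom)) →
        (reidemeisterNumber φ.toMonoidHom : ℚ) =
          ((|(1 - D).det| : ℤ) + (|(1 + D).det| : ℤ)) / 2 + solCount (1 - D) d) := by
  obtain ⟨D, hD⟩ := exists_mat φ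
  obtain ⟨d, hd⟩ := map_rf φ 0
  refine ⟨D, d, mat_isUnit φ D hD, hD, hd, fun hfin => ?_⟩
  obtain ⟨e⟩ := twisted_equiv φ D d hD hd
  have hs : Finite (Quot (dbl (1 - D) (-d)) ⊕ Quot (dbl (1 + D) d)) := Finite.of_equiv _ e
  have f1 : Finite (Quot (dbl (1 - D) (-d))) := Finite.of_injective _ Sum.inl_injective (β := _ ⊕ Quot (dbl (1 + D) d))
  have f2 : Finite (Quot (dbl (1 + D) d)) := Finite.of_injective _ Sum.inr_injective (β := Quot (dbl (1 - D) (-d)) ⊕ _)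
  have k1 := dbl_card _ _ f1
  have k2 := dbl_card _ _ f2
  rw [solCount_neg] at k1
  rw [solCount_add] at k2
  rw [reidemeisterNumber, Nat.card_congr e, Nat.card_sum]
  rw [Int.abs_eq_natAbs, Int.abs_eq_natAbs]
  have k1' := congrArg (Nat.cast : ℕ → ℚ) k1
  have k2' := congrArg (Nat.cast : ℕ → ℚ) k2
  push_cast at k1' k2'
  simp only [Int.cast_natCast, Nat.cast_add]
  linarith
end

section
/- Let D be an n × n matrix over a field 𝔽. Then there exist non-negative integers k and l with k + l = n, an invertible n × n matrix P over 𝔽, a unipotent upper-triangular k × k matrix D₁ (upper-triangular with all diagonal entries equal to 1), and an l × l matrix D₂ with det(I_l − D₂) ≠ 0 (i.e., D₂ does not have eigenvalue 1 in 𝔽), such that P D P⁻¹ is the block-diagonal matrix with blocks D₁ and D₂. -/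
open Matrix

theorem aux_nilp {F : Type*} [Field F] (k : ℕ) : ∀ {V : Type _} [AddCommGroup V] [Module F V]
    [FiniteDimensional F V] (N : V →ₗ[F] V), IsNilpotent N → Module.finrank F V = k →
    ∃ b : Module.Basis (Fin k) F V, ∀ i j, j ≤ i → b.repr (N (b j)) i = 0 := by
  induction k with
  | zero =>
    intro V _ _ _ N hN hk
    exact ⟨Module.finBasisOfFinrankEq F V hk, fun i => i.elim0⟩
  | succ k ih =>
    intro V _ _ _ N hN hk
    have hne : LinearMap.range N ≠ ⊤ := by
      intro h
      have hs := LinearMap.range_eq_top.mp h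
      obtain ⟨m, hm⟩ := hN
      have h2 : Function.Surjective (N ^ m) := by
        rw [Module.End.coe_pow]; exact hs.iterate m
      have : Subsingleton V := by
        refine subsingleton_of_forall_eq 0 fun y => ?_
        obtain ⟨x, rfl⟩ := h2 y
        simp [hm]
      have := Module.finrank_zero_of_subsingleton (R := F) (M := V)
      omega
    obtain ⟨φ, hφ, hle⟩ := Submodule.exists_le_ker_of_lt_top _ (lt_top_iff_ne_top.2 hne)
    have hW : Module.finrank F (LinearMap.ker φ) = k := by
      have := Module.Dual.finrank_ker_add_one_of_ne_zero hφ
      omega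
    have hNW : ∀ x, N x ∈ LinearMap.ker φ := fun x => hle ⟨x, rfl⟩
    obtain ⟨b, hb⟩ := ih (N.restrict (p := LinearMap.ker φ) (q := LinearMap.ker φ) fun x _ => hNW x)
      (by
        obtain ⟨m, hm⟩ := hN
        refine ⟨m, ?_⟩
        rw [Module.End.pow_restrict]
        ext x
        simp [hm]) hW
    obtain ⟨y, hy⟩ : ∃ y, φ y ≠ 0 := by
      by_contra! h
      exact hφ (LinearMap.ext h)
    obtain ⟨B, hB⟩ : ∃ B : Module.Basis (Fin (k+1)) F V,
        (B : Fin (k+1) → V) = Fin.snoc ((↑) ∘ b) y := by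
      refine ⟨_, Module.Basis.coe_mkFinSnoc b y ?_ ?_⟩
      · intro c x hx h
        have := congrArg φ h
        rw [LinearMap.mem_ker] at hx
        simpa [hx, hy] using this
      · intro z
        refine ⟨-(φ z / φ y), ?_⟩
        simp [LinearMap.mem_ker, hy]
    have hBc : ∀ j : Fin k, B j.castSucc = b j := by
      intro j; rw [hB]; simp
    have hw : ∀ w : LinearMap.ker φ, (w : V) = ∑ j, b.repr w j • B j.castSucc := by
      intro w
      have := congrArg (LinearMap.ker φ).subtype (b.sum_repr w)
      rw [map_sum] at this
      simpa [hBc] using this.symm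
    have hlast : ∀ w : LinearMap.ker φ, B.repr w (Fin.last k) = 0 := by
      intro w
      rw [hw w]
      simp [Fin.castSucc_ne_last]
    have hcs : ∀ (w : LinearMap.ker φ) i, B.repr w (Fin.castSucc i) = b.repr w i := by
      intro w i
      conv_lhs => rw [hw w]
      simp [Finsupp.single_apply]
    refine ⟨B, fun i j hij => ?_⟩
    induction i using Fin.lastCases with
    | last => exact hlast ⟨_, hNW _⟩
    | cast i =>
      induction j using Fin.lastCases with
      | last => exact absurd hij (by simp)
      | cast j =>
        rw [hBc]
        exact (hcs ⟨_, hNW _⟩ i).trans (hb i j (by simpa using hij))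

/-- any square matrix `D` over a field is conjugate to a block-diagonal matrix
`diag(D₁, D₂)` with `D₁` unipotent upper-triangular and `D₂` without eigenvalue `1`
(i.e. `det(I - D₂) ≠ 0`). -/
theorem stmt5 {F : Type*} [Field F] (n : ℕ) (D : Matrix (Fin n) (Fin n) F) :
    ∃ (k l : ℕ) (h : k + l = n) (P : Matrix (Fin n) (Fin n) F)
      (D₁ : Matrix (Fin k) (Fin k) F) (D₂ : Matrix (Fin l) (Fin l) F),
      IsUnit P ∧
      (∀ i : Fin k, D₁ i i = 1) ∧ (∀ i j : Fin k, j < i → D₁ i j = 0) ∧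
      (1 - D₂).det ≠ 0 ∧
      P * D * P⁻¹ =
        Matrix.reindex (finSumFinEquiv.trans (finCongr h)) (finSumFinEquiv.trans (finCongr h))
          (Matrix.fromBlocks D₁ 0 0 D₂) := by
  let A : Module.End F (Fin n → F) := Matrix.toLin' D
  let f : Module.End F (Fin n → F) := A - 1
  obtain ⟨m, hc, hm⟩ := (f.eventually_isCompl_ker_pow_range_pow.and
    (Filter.eventually_ge_atTop 1)).exists
  set K := LinearMap.ker (f ^ m) with hKdef
  set R := LinearMap.range (f ^ m) with hRdef
  have hcomm : ∀ x, (f ^ m) (f x) = f ((f ^ m) x) := fun x => by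
    rw [← Module.End.mul_apply, ← Module.End.mul_apply, ← pow_succ, ← pow_succ']
  have hA : ∀ x, A x = f x + x := fun x => by simp [f]
  have hfK : ∀ x ∈ K, f x ∈ K := fun x hx => by
    rw [hKdef, LinearMap.mem_ker] at hx ⊢
    rw [hcomm, hx, map_zero]
  have hfR : ∀ x ∈ R, f x ∈ R := by
    rintro _ ⟨x, rfl⟩
    exact ⟨f x, hcomm x⟩
  have hAK : ∀ x ∈ K, A x ∈ K := fun x hx => by rw [hA]; exact K.add_mem (hfK x hx) hx
  have hAR : ∀ x ∈ R, A x ∈ R := fun x hx => by rw [hA]; exact R.add_mem (hfR x hx) hx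
  obtain ⟨b₁, hb₁⟩ := aux_nilp _ (f.restrict hfK) (by
    refine ⟨m, ?_⟩
    rw [Module.End.pow_restrict]
    ext x
    exact congrFun x.2 _) rfl
  let b₂ := Module.finBasis F R
  have h : Module.finrank F K + Module.finrank F R = n := by
    simpa using Submodule.finrank_add_eq_of_isCompl hc
  let e := finSumFinEquiv.trans (finCongr h)
  let B₀ := (b₁.prod b₂).map (K.prodEquivOfIsCompl R hc)
  let B := B₀.reindex e
  let s := Pi.basisFun F (Fin n)
  have hPP : B.toMatrix s * s.toMatrix B = 1 := B.toMatrix_mul_toMatrix_flip s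
  have hinv : (B.toMatrix s)⁻¹ = s.toMatrix B := Matrix.inv_eq_right_inv hPP
  have hD : LinearMap.toMatrix s s A = D := by
    exact LinearMap.toMatrix'_toLin' D
  have hrK : ∀ x : K, ∀ i, B₀.repr (x : Fin n → F) i = Sum.elim (b₁.repr x) 0 i := by
    intro x i
    cases i <;> simp [B₀]
  have hrR : ∀ x : R, ∀ i, B₀.repr (x : Fin n → F) i = Sum.elim (fun _ => (0 : F)) (b₂.repr x) i := by
    intro x i
    cases i <;> simp [B₀]
  refine ⟨_, _, h, B.toMatrix s, LinearMap.toMatrix b₁ b₁ (A.restrict hAK),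
    LinearMap.toMatrix b₂ b₂ (A.restrict hAR), ?_, ?_, ?_, ?_, ?_⟩
  · exact IsUnit.of_mul_eq_one _ hPP
  · intro i
    have : A.restrict hAK (b₁ i) = f.restrict hfK (b₁ i) + b₁ i := Subtype.ext (hA _)
    rw [LinearMap.toMatrix_apply, this, map_add, Finsupp.add_apply, hb₁ i i le_rfl]
    simp
  · intro i j hij
    have : A.restrict hAK (b₁ j) = f.restrict hfK (b₁ j) + b₁ j := Subtype.ext (hA _)
    rw [LinearMap.toMatrix_apply, this, map_add, Finsupp.add_apply, hb₁ i j hij.le]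
    simp [hij.ne]
  · have h1 : 1 - LinearMap.toMatrix b₂ b₂ (A.restrict hAR)
        = LinearMap.toMatrix b₂ b₂ (LinearMap.id - A.restrict hAR) := by
      rw [← LinearMap.toMatrix_id b₂]
      exact (map_sub (LinearMap.toMatrix b₂ b₂) _ _).symm
    rw [h1, LinearMap.det_toMatrix]
    intro h0
    have := LinearMap.bot_lt_ker_of_det_eq_zero h0
    refine this.ne' ((Submodule.eq_bot_iff _).2 fun x hx => ?_)
    have hx' : (x : Fin n → F) - A x = 0 := congrArg Subtype.val hx
    have hfx : f x = 0 := by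
      have := hA x
      rw [← sub_eq_zero.1 hx'] at this
      simpa using this
    have hxK : (x : Fin n → F) ∈ K := by
      obtain ⟨p, rfl⟩ := Nat.exists_eq_add_of_le' hm
      rw [hKdef, LinearMap.mem_ker, pow_succ, Module.End.mul_apply, hfx, map_zero]
    exact Subtype.ext (Submodule.disjoint_def.1 hc.disjoint _ hxK x.2)
  · rw [hinv]
    have hfin : B.toMatrix s * D * s.toMatrix B = LinearMap.toMatrix B B A := by
      conv_lhs => rw [← hD]
      clear_value B s
      exact basis_toMatrix_mul_linearMap_toMatrix_mul_basis_toMatrix (b := B) (b' := s)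
        (c := B) (c' := s) A
    rw [hfin]
    have h0 : LinearMap.toMatrix B₀ B₀ A = Matrix.fromBlocks
        (LinearMap.toMatrix b₁ b₁ (A.restrict hAK)) 0 0
        (LinearMap.toMatrix b₂ b₂ (A.restrict hAR)) := by
      ext i j
      rw [LinearMap.toMatrix_apply]
      rcases j with j | j
      · have : A (B₀ (Sum.inl j)) = (A.restrict hAK (b₁ j) : K) := by simp [B₀]
        rw [this, hrK]
        cases i <;> simp [LinearMap.toMatrix_apply]
      · have : A (B₀ (Sum.inr j)) = (A.restrict hAR (b₂ j) : R) := by simp [B₀]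
        rw [this, hrR]
        cases i <;> simp [LinearMap.toMatrix_apply]
    rw [← h0]
    ext i j
    rw [LinearMap.toMatrix_apply, Module.Basis.repr_reindex_apply, Module.Basis.reindex_apply,
      Matrix.reindex_apply, Matrix.submatrix_apply, LinearMap.toMatrix_apply]
end

section
/- Let n ≥ 2, let Γₙ = ℤⁿ ⋊ ℤ/2ℤ (with the nontrivial element acting by negation), and let φ be an automorphism of Γₙ such that R(φᵏ) is finite for every positive integer k. Then there exist non-negative integers a, b, l, complex numbers μ₁, …, μ_a, ν₁, …, ν_b, and non-negative integers c₁, …, c_l, such that, setting r = 1 / max{1, |μ₁|, …, |μ_a|, |ν₁|, …, |ν_b|}: the power series ∑_{k=1}^{∞} R(φᵏ) zᵏ/k has radius of convergence r, and for all complex z with |z| < r, exp( ∑_{k=1}^{∞} R(φᵏ) zᵏ/k ) = ∏_{i=1}^{b}(1 − νᵢ z) / ( ∏_{i=1}^{a}(1 − μᵢ z) · ∏_{i=1}^{l}(1 − zⁱ)^{cᵢ} ). -/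
open Matrix NNReal


section PartA
open Function

lemma dvd_card_minimalPeriod {V : Type*} [Fintype V] [DecidableEq V] (f : V → V) (m : ℕ) (hm : 0 < m) :
    m ∣ (Finset.univ.filter (fun x => minimalPeriod f x = m)).card := by
  classical
  set P := Finset.univ.filter (fun x => minimalPeriod f x = m) with hP
  let g : V → Finset V := fun x => (Finset.range m).image (fun i => f^[i] x)
  have hper : ∀ x ∈ P, x ∈ periodicPts f := by
    intro x hx
    rw [hP, Finset.mem_filter] at hx
    exact minimalPeriod_pos_iff_mem_periodicPts.1 (hx.2 ▸ hm)
  have hmp : ∀ x ∈ P, minimalPeriod f x = m := by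
    intro x hx
    rw [hP, Finset.mem_filter] at hx
    exact hx.2
  have hmem : ∀ x ∈ P, ∀ i, f^[i] x ∈ g x := by
    intro x hx i
    refine Finset.mem_image.2 ⟨i % m, Finset.mem_range.2 (Nat.mod_lt _ hm), ?_⟩
    have := iterate_mod_minimalPeriod_eq (f := f) (x := x) (n := i)
    rw [hmp x hx] at this
    exact this
  have hself : ∀ x, x ∈ g x := by
    intro x
    exact Finset.mem_image.2 ⟨0, Finset.mem_range.2 hm, rfl⟩
  have hsub : ∀ x ∈ P, ∀ y ∈ g x, g y ⊆ g x := by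
    intro x hx y hy z hz
    obtain ⟨i, hi, rfl⟩ := Finset.mem_image.1 hy
    obtain ⟨j, hj, rfl⟩ := Finset.mem_image.1 hz
    rw [← iterate_add_apply]
    exact hmem x hx _
  have hback : ∀ x ∈ P, ∀ y ∈ g x, x ∈ g y ∧ y ∈ P := by
    intro x hx y hy
    obtain ⟨i, hi, rfl⟩ := Finset.mem_image.1 hy
    have hi := Finset.mem_range.1 hi
    have hyP : f^[i] x ∈ P := by
      rw [hP, Finset.mem_filter]
      exact ⟨Finset.mem_univ _, by rw [minimalPeriod_apply_iterate (hper x hx), hmp x hx]⟩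
    refine ⟨?_, hyP⟩
    have := hmem _ hyP (m - i)
    rw [← iterate_add_apply, Nat.sub_add_cancel hi.le] at this
    have h2 := iterate_minimalPeriod (f := f) (x := x)
    rw [hmp x hx] at h2
    rwa [h2] at this
  have hfib : ∀ x ∈ P, P.filter (fun y => g y = g x) = g x := by
    intro x hx
    ext y
    rw [Finset.mem_filter]
    constructor
    · rintro ⟨_, h⟩
      rw [← h]; exact hself y
    · intro hy
      obtain ⟨h1, h2⟩ := hback x hx y hy
      exact ⟨h2, (hsub x hx y hy).antisymm (hsub y h2 x h1)⟩
  have hcard : ∀ x ∈ P, (g x).card = m := by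
    intro x hx
    rw [Finset.card_image_of_injOn, Finset.card_range]
    intro i hi j hj hij
    apply iterate_injOn_Iio_minimalPeriod (f := f) (x := x) _ _ hij
    · rw [hmp x hx]; simpa using hi
    · rw [hmp x hx]; simpa using hj
  rw [Finset.card_eq_sum_card_image g P]
  apply Finset.dvd_sum
  intro b hb
  obtain ⟨x, hx, rfl⟩ := Finset.mem_image.1 hb
  rw [hfib x hx, hcard x hx]

lemma fix_count {V : Type*} [Finite V] (f : V → V) :
    ∃ (l : ℕ) (c : Fin l → ℕ), ∀ k : ℕ, 0 < k →
      Nat.card {x : V // f^[k] x = x} = ∑ i : Fin l, (if (i : ℕ) + 1 ∣ k then ((i : ℕ) + 1) * c i else 0) := by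
  classical
  have := Fintype.ofFinite V
  let l := Finset.univ.sup (minimalPeriod f)
  refine ⟨l, fun i => (Finset.univ.filter (fun x => minimalPeriod f x = (i : ℕ) + 1)).card / ((i : ℕ) + 1), ?_⟩
  intro k hk
  have e : ∀ i : Fin l, (if (i : ℕ) + 1 ∣ k then ((i : ℕ) + 1) *
      ((Finset.univ.filter (fun x => minimalPeriod f x = (i : ℕ) + 1)).card / ((i : ℕ) + 1)) else 0) =
      ((Finset.univ.filter (fun x => f^[k] x = x)).filter (fun x => minimalPeriod f x = (i : ℕ) + 1)).card := by
    intro i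
    split_ifs with h
    · rw [Nat.mul_div_cancel' (dvd_card_minimalPeriod f _ (Nat.succ_pos _)), Finset.filter_filter]
      congr 1
      apply Finset.filter_congr
      intro x _
      constructor
      · intro hx
        refine ⟨?_, hx⟩
        exact isPeriodicPt_iff_minimalPeriod_dvd.2 (hx ▸ h)
      · exact fun hx => hx.2
    · symm
      rw [Finset.card_eq_zero, Finset.filter_eq_empty_iff]
      intro x hx hx2
      apply h
      rw [← hx2]
      exact isPeriodicPt_iff_minimalPeriod_dvd.1 (Finset.mem_filter.1 hx).2
  rw [Finset.sum_congr rfl (fun i _ => e i), Nat.card_eq_fintype_card, Fintype.card_subtype]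
  rw [Fin.sum_univ_eq_sum_range (fun i => ((Finset.univ.filter (fun x => f^[k] x = x)).filter (fun x => minimalPeriod f x = i + 1)).card) l]
  rw [Finset.card_eq_sum_card_fiberwise (f := fun x => minimalPeriod f x - 1) (t := Finset.range l)]
  · refine Finset.sum_congr rfl fun i _ => ?_
    congr 1
    apply Finset.filter_congr
    intro x hx
    have : 0 < minimalPeriod f x :=
      IsPeriodicPt.minimalPeriod_pos hk (Finset.mem_filter.1 hx).2
    omega
  · intro x hx
    have h0 : 0 < minimalPeriod f x :=
      IsPeriodicPt.minimalPeriod_pos hk (Finset.mem_filter.1 hx).2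
    have h1 : minimalPeriod f x ≤ l := Finset.le_sup (f := minimalPeriod f) (Finset.mem_univ x)
    simp only [Finset.coe_range, Set.mem_Iio]
    omega
end PartA
section PartB
open Polynomial

lemma det_sub_scalar {n : ℕ} (A : Matrix (Fin n) (Fin n) ℂ) (a : ℂ) :
    (A - Matrix.scalar (Fin n) a).det = (A.charpoly.roots.map (fun l => l - a)).prod := by
  have hs : A.charpoly.Splits := IsAlgClosed.splits _
  have hc : Multiset.card A.charpoly.roots = n := by
    rw [← hs.natDegree_eq_card_roots, Matrix.charpoly_natDegree_eq_dim, Fintype.card_fin]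
  have h1 : (A.charpoly).eval a = (A.charpoly.roots.map (fun l => a - l)).prod := by
    conv_lhs => rw [hs.eq_prod_roots_of_monic (Matrix.charpoly_monic A)]
    rw [Polynomial.eval_multiset_prod, Multiset.map_map]
    simp
  rw [Matrix.eval_charpoly] at h1
  rw [← neg_sub, Matrix.det_neg, h1, Fintype.card_fin]
  have : (A.charpoly.roots.map (fun l => l - a)) = (A.charpoly.roots.map (fun l => (-1) * (a - l))) := by
    congr 1; ext l; ring
  rw [this, Multiset.prod_map_mul]
  simp [hc]

lemma det_aeval_prod {n : ℕ} (A : Matrix (Fin n) (Fin n) ℂ) (p : ℂ[X]) (hp : p.Monic) :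
    (aeval A p).det = (A.charpoly.roots.map (fun l => p.eval l)).prod := by
  have hs : p.Splits := IsAlgClosed.splits _
  rw [hs.eq_prod_roots_of_monic hp]
  induction p.roots using Multiset.induction with
  | empty => simp
  | cons a s ih =>
    simp only [Multiset.map_cons, Multiset.prod_cons, map_mul, Matrix.det_mul, ih, eval_mul,
      Multiset.prod_map_mul]
    congr 1
    rw [← (by simpa using det_sub_scalar A a : _ = (A.charpoly.roots.map (fun l => eval l (X - C a))).prod)]
    simp [Matrix.algebraMap_eq_diagonal]
    rfl

lemma prod_norm_eq (L : Multiset ℂ) (hL : L.map (starRingEnd ℂ) = L) (g u : ℂ → ℂ)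
    (hg : ∀ l, g (starRingEnd ℂ l) = starRingEnd ℂ (g l))
    (hu1 : ∀ l, l.im ≠ 0 → u l = 1)
    (hu : ∀ l ∈ L, l.im = 0 → (‖g l‖ : ℂ) = u l * g l) :
    (L.map (fun l => (‖g l‖ : ℂ))).prod = (L.map u).prod * (L.map g).prod := by
  classical
  rw [← Multiset.prod_map_mul]
  have hd : L = L.filter (fun l => l.im = 0) + (L.filter (fun l => 0 < l.im)
      + L.filter (fun l => l.im < 0)) := by
    conv_lhs => rw [← Multiset.filter_add_not (fun l : ℂ => l.im = 0) L]
    congr 1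
    conv_lhs => rw [← Multiset.filter_add_not (fun l : ℂ => 0 < l.im) (L.filter _)]
    rw [Multiset.filter_filter, Multiset.filter_filter]
    congr 1
    · apply Multiset.filter_congr
      intro x _
      constructor
      · exact fun h => h.1
      · exact fun h => ⟨h, h.ne'⟩
    · apply Multiset.filter_congr
      intro x _
      constructor
      · exact fun h => lt_of_le_of_ne (not_lt.1 h.1) h.2
      · exact fun h => ⟨not_lt.2 h.le, h.ne⟩
  have hneg : L.filter (fun l => l.im < 0) =
      (L.filter (fun l => 0 < l.im)).map (starRingEnd ℂ) := by
    conv_lhs => rw [← hL]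
    rw [Multiset.filter_map]
    congr 1
    apply Multiset.filter_congr
    intro x _
    simp
  rw [hneg] at hd
  have key : ∀ F : ℂ → ℂ, (L.map F).prod = ((L.filter (fun l => l.im = 0)).map F).prod *
      ((L.filter (fun l => 0 < l.im)).map (fun l => F l * F (starRingEnd ℂ l))).prod := by
    intro F
    conv_lhs => rw [hd]
    simp only [Multiset.map_add, Multiset.prod_add, Multiset.map_map, Multiset.prod_map_mul]
    rfl
  rw [key, key (fun l => u l * g l)]
  congr 1
  · congr 1
    apply Multiset.map_congr rfl
    intro l hl
    rw [Multiset.mem_filter] at hl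
    exact hu l hl.1 hl.2
  · congr 1
    apply Multiset.map_congr rfl
    intro l hl
    rw [Multiset.mem_filter] at hl
    rw [hu1 l hl.2.ne', hu1 _ (by simpa using hl.2.ne'), hg, one_mul, one_mul, Complex.mul_conj,
      RCLike.norm_conj, Complex.normSq_eq_norm_sq]
    push_cast; ring

noncomputable def sgnS (l : ℂ) : ℂ := if l.im = 0 ∧ l.re < -1 then -1 else 1
noncomputable def sgnT (l : ℂ) : ℂ := if l.im = 0 ∧ 1 < |l.re| then -1 else 1

lemma sgn_real (x : ℝ) (hx : |x| ≠ 1) (k : ℕ) (hk : 0 < k) :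
    (|1 - x ^ k| = (if 1 < |x| then -1 else 1) * (if x < -1 then -1 else 1) ^ k * (1 - x ^ k)) ∧
    (|1 + x ^ k| = (if x < -1 then -1 else 1) ^ k * (1 + x ^ k)) := by
  rcases lt_or_gt_of_ne hx with h | h
  · have h' := abs_lt.1 h
    have : |x ^ k| < 1 := by rw [abs_pow]; exact pow_lt_one₀ (abs_nonneg _) h hk.ne'
    have := abs_lt.1 this
    rw [if_neg (not_lt.2 h.le), if_neg (not_lt.2 h'.1.le), abs_of_pos (by linarith), abs_of_pos (by linarith)]
    simp
  · rw [if_pos h]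
    rcases lt_abs.1 h with h1 | h1
    · have : 1 < x ^ k := one_lt_pow₀ h1 hk.ne'
      rw [if_neg (by linarith), abs_of_neg (by linarith), abs_of_pos (by linarith)]
      simp
    · rw [if_pos (by linarith)]
      have h2 : 1 < (-x) ^ k := one_lt_pow₀ h1 hk.ne'
      rcases Nat.even_or_odd k with he | ho
      · rw [he.neg_pow] at h2
        rw [he.neg_one_pow, abs_of_neg (by linarith), abs_of_pos (by linarith)]
        constructor <;> ring
      · rw [ho.neg_pow] at h2
        rw [ho.neg_one_pow, abs_of_pos (by linarith), abs_of_neg (by linarith)]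
        constructor <;> ring

lemma multiset_map_prod_pm (L : Multiset ℂ) (f : ℂ → ℂ) (hf : ∀ l, f l = 1 ∨ f l = -1) :
    (L.map f).prod = 1 ∨ (L.map f).prod = -1 := by
  induction L using Multiset.induction with
  | empty => simp
  | cons a s ih =>
    rw [Multiset.map_cons, Multiset.prod_cons]
    rcases hf a with h | h <;> rcases ih with h' | h' <;> simp [h, h']

lemma exists_index (L : Multiset ℂ) (n : ℕ) (hc : Multiset.card L = n) :
    ∃ Λ : Fin n → ℂ, Multiset.map Λ Finset.univ.val = L := by
  subst hc
  induction L using Quotient.inductionOn with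
  | h l => exact ⟨fun i : Fin l.length => l.get i, (Fin.univ_val_map _).trans (congrArg _ (List.ofFn_get l))⟩

lemma det_norms {n : ℕ} (A : Matrix (Fin n) (Fin n) ℤ)
    (h1 : ∀ k : ℕ, 0 < k → (1 - A ^ k).det ≠ 0) :
    ∃ (Λ : Fin n → ℂ) (σ τ : ℂ), (τ = 1 ∨ τ = -1) ∧ ∀ k : ℕ, 0 < k →
      ((|(1 - A ^ k).det| : ℤ) : ℂ) = τ * σ ^ k * ∏ i, (1 - Λ i ^ k) ∧
      ((|(1 + A ^ k).det| : ℤ) : ℂ) = σ ^ k * ∏ i, (1 + Λ i ^ k) := by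
  classical
  set B : Matrix (Fin n) (Fin n) ℂ := A.map (Int.castRingHom ℂ) with hB
  set L := B.charpoly.roots with hL
  have hs : B.charpoly.Splits := IsAlgClosed.splits _
  have hc : Multiset.card L = n := by
    rw [hL, ← hs.natDegree_eq_card_roots, Matrix.charpoly_natDegree_eq_dim, Fintype.card_fin]
  have hconj : L.map (starRingEnd ℂ) = L := by
    rw [hL, ← hs.roots_map (starRingEnd ℂ), ← Matrix.charpoly_map]
    congr 2
    ext i j
    simp [hB]
  have hdet : ∀ (p : ℤ[X]), p.Monic →
      ((((aeval A p).det : ℤ)) : ℂ) = (L.map (fun l => (p.map (Int.castRingHom ℂ)).eval l)).prod := by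
    intro p hp
    rw [hL, ← det_aeval_prod B _ (hp.map _)]
    have := RingHom.map_det (Int.castRingHom ℂ) (aeval A p)
    simp only [eq_intCast] at this
    rw [this]
    congr 1
    have h3 := Polynomial.map_aeval_eq_aeval_map (S := Matrix (Fin n) (Fin n) ℤ) (U := Matrix (Fin n) (Fin n) ℂ)
      (φ := Int.castRingHom ℂ) (ψ := (Int.castRingHom ℂ).mapMatrix) (by ext x i j; simp) p A
    exact h3
  have hminus : ∀ k : ℕ, 0 < k →
      ((((A ^ k - 1).det : ℤ)) : ℂ) = (L.map (fun l => l ^ k - 1)).prod := by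
    intro k hk
    have := hdet (X ^ k - 1) (monic_X_pow_sub_C 1 hk.ne')
    simpa using this
  have hplus : ∀ k : ℕ, 0 < k →
      ((((1 + A ^ k).det : ℤ)) : ℂ) = (L.map (fun l => 1 + l ^ k)).prod := by
    intro k hk
    have := hdet (1 + X ^ k) (by rw [add_comm]; exact monic_X_pow_add_C 1 hk.ne')
    simpa using this
  have habs : ∀ M : Matrix (Fin n) (Fin n) ℤ, ((|M.det| : ℤ) : ℂ) = ((‖((M.det : ℤ) : ℂ)‖ : ℝ) : ℂ) := by
    intro M
    generalize M.det = m
    rw [Complex.norm_intCast, ← Int.cast_abs, Complex.ofReal_intCast]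
  have hnorm : ∀ (g : ℂ → ℂ), ((‖(L.map g).prod‖ : ℝ) : ℂ) = (L.map (fun l => (‖g l‖ : ℂ))).prod := by
    intro g
    generalize L = L'
    induction L' using Multiset.induction with
    | empty => simp
    | cons a s ih => simp [ih]
  have hL1 : ∀ l ∈ L, l.im = 0 → |l.re| ≠ 1 := by
    intro l hl him hre
    have h2 := h1 2 (by norm_num)
    apply h2
    have h3 := hminus 2 (by norm_num)
    have h4 : l ^ 2 - 1 = 0 := by
      have : l = (l.re : ℂ) := by apply Complex.ext <;> simp [him]
      rw [this]
      norm_cast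
      have := sq_abs l.re
      rw [hre] at this
      linarith
    rw [Multiset.prod_eq_zero (Multiset.mem_map.2 ⟨l, hl, h4⟩)] at h3
    rw [← neg_sub, Matrix.det_neg]
    have : (A ^ 2 - 1).det = 0 := by exact_mod_cast h3
    rw [this, mul_zero]
  obtain ⟨Λ, hΛ⟩ : ∃ Λ : Fin n → ℂ, Multiset.map Λ Finset.univ.val = L := exists_index L n hc
  have hprod : ∀ f : ℂ → ℂ, (L.map f).prod = ∏ i, f (Λ i) := by
    intro f
    rw [← hΛ, Multiset.map_map]
    rfl
  refine ⟨Λ, (L.map sgnS).prod, (L.map sgnT).prod, ?_, ?_⟩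
  · apply multiset_map_prod_pm
    intro l
    unfold sgnT
    split_ifs <;> simp
  · intro k hk
    constructor
    · have e1 : |(1 - A ^ k).det| = |(A ^ k - 1).det| := by
        rw [← neg_sub, Matrix.det_neg, abs_mul, abs_pow]; simp
      rw [e1, habs, hminus k hk, hnorm]
      have := prod_norm_eq L hconj (fun l => 1 - l ^ k) (fun l => sgnT l * sgnS l ^ k) (by intro l; simp)
        (by intro l hl; simp [sgnT, sgnS, hl])
        (by
          intro l hl him
          have hx := (sgn_real l.re (hL1 l hl him) k hk).1
          have hll : l = (l.re : ℂ) := by apply Complex.ext <;> simp [him]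
          simp only [sgnT, sgnS, him, true_and]
          rw [hll]
          simp only [Complex.ofReal_re]
          rw [show (1 - (l.re : ℂ) ^ k) = ((1 - l.re ^ k : ℝ) : ℂ) by push_cast; rfl, Complex.norm_real,
            Real.norm_eq_abs, hx]
          split_ifs <;> push_cast <;> rfl)
      simp only [norm_sub_rev _ (1 : ℂ)]
      rw [this, Multiset.prod_map_mul, Multiset.prod_map_pow, hprod (fun l => 1 - l ^ k)]
    · rw [habs, hplus k hk, hnorm]
      have := prod_norm_eq L hconj (fun l => 1 + l ^ k) (fun l => sgnS l ^ k) (by intro l; simp)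
        (by intro l hl; simp [sgnS, hl])
        (by
          intro l hl him
          have hx := (sgn_real l.re (hL1 l hl him) k hk).2
          have hll : l = (l.re : ℂ) := by apply Complex.ext <;> simp [him]
          simp only [sgnS, him, true_and]
          rw [hll]
          simp only [Complex.ofReal_re]
          rw [show (1 + (l.re : ℂ) ^ k) = ((1 + l.re ^ k : ℝ) : ℂ) by push_cast; rfl, Complex.norm_real,
            Real.norm_eq_abs, hx]
          split_ifs <;> push_cast <;> rfl)
      rw [this, Multiset.prod_map_pow, hprod (fun l => 1 + l ^ k)]

lemma eigen_sum {n : ℕ} (A : Matrix (Fin n) (Fin n) ℤ)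
    (h1 : ∀ k : ℕ, 0 < k → (1 - A ^ k).det ≠ 0) :
    ∃ (a : ℕ) (μ : Fin a → ℂ), ∀ k : ℕ, 0 < k →
      ((|(1 - A ^ k).det| : ℤ) : ℂ) + ((|(1 + A ^ k).det| : ℤ) : ℂ) = 2 * ∑ i, μ i ^ k := by
  classical
  obtain ⟨Λ, σ, τ, hτ, h⟩ := det_norms A h1
  let 𝒮 : Finset (Finset (Fin n)) := Finset.univ.powerset.filter (fun S => (-1 : ℂ) ^ S.card = τ)
  refine ⟨𝒮.card, fun i => σ * ∏ j ∈ (𝒮.equivFin.symm i : Finset (Fin n)), Λ j, ?_⟩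
  intro k hk
  rw [(h k hk).1, (h k hk).2]
  have e1 : ∑ i, (σ * ∏ j ∈ (𝒮.equivFin.symm i : Finset (Fin n)), Λ j) ^ k =
      ∑ S ∈ 𝒮, (σ * ∏ j ∈ S, Λ j) ^ k := by
    rw [Equiv.sum_comp 𝒮.equivFin.symm (fun S => (σ * ∏ j ∈ (S : Finset (Fin n)), Λ j) ^ k)]
    exact Finset.sum_coe_sort 𝒮 (fun S => (σ * ∏ j ∈ S, Λ j) ^ k)
  rw [e1]
  have e2 : ∏ i, (1 - Λ i ^ k) = ∑ S ∈ Finset.univ.powerset, (-1) ^ S.card * ∏ j ∈ S, Λ j ^ k := by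
    have : ∀ i, 1 - Λ i ^ k = 1 + (-1) * Λ i ^ k := fun i => by ring
    simp only [this]
    rw [Finset.prod_one_add]
    refine Finset.sum_congr rfl fun S _ => ?_
    rw [Finset.prod_mul_distrib, Finset.prod_const]
  rw [e2, Finset.prod_one_add, Finset.sum_filter, Finset.mul_sum, Finset.mul_sum, Finset.mul_sum,
    ← Finset.sum_add_distrib]
  refine Finset.sum_congr rfl fun S _ => ?_
  rw [Finset.prod_pow, mul_pow]
  rcases neg_one_pow_eq_or ℂ S.card with hS | hS <;> rcases hτ with hτ | hτ <;> rw [hS, hτ] <;>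
    norm_num <;> ring
end PartB
section PartC

lemma card_quot_involution {C : Type*} [Finite C] (s : C → C) (hs : ∀ x, s (s x) = x) :
    2 * Nat.card (Quot (fun x y => x = y ∨ x = s y)) = Nat.card C + Nat.card {x : C // s x = x} := by
  classical
  have := Fintype.ofFinite C
  let r : C → C → Prop := fun x y => x = y ∨ x = s y
  have hr : Equivalence r := by
    refine ⟨fun x => Or.inl rfl, ?_, ?_⟩
    · rintro x y (h | h)
      · exact Or.inl h.symm
      · right; rw [h, hs]
    · rintro x y z (rfl | rfl) (rfl | rfl)
      · exact Or.inl rfl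
      · exact Or.inr rfl
      · exact Or.inr rfl
      · left; rw [hs]
  have : Finite (Quot r) := Finite.of_surjective (Quot.mk r) Quot.mk_surjective
  have := Fintype.ofFinite (Quot r)
  have hq : ∀ x y, Quot.mk r x = Quot.mk r y ↔ r x y := by
    intro x y
    rw [Quot.eq, hr.eqvGen_iff]
  change 2 * Nat.card (Quot r) = _
  rw [Nat.card_eq_fintype_card, Nat.card_eq_fintype_card, Nat.card_eq_fintype_card, Fintype.card_subtype,
    ← Finset.card_univ (α := C), Finset.card_eq_sum_card_fiberwise (f := Quot.mk r) (s := Finset.univ) (t := Finset.univ) (by simp),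
    Finset.card_eq_sum_card_fiberwise (f := Quot.mk r) (s := Finset.univ.filter _) (t := Finset.univ) (by simp),
    ← Finset.sum_add_distrib, mul_comm, ← Finset.card_univ (α := Quot r), ← smul_eq_mul, ← Finset.sum_const]
  refine Finset.sum_congr rfl fun q _ => ?_
  obtain ⟨x, rfl⟩ := Quot.mk_surjective q
  simp only [hq, Finset.filter_filter]
  by_cases hx : s x = x
  · have e1 : Finset.univ.filter (fun a => r a x) = {x} := by
      ext a; simp [r, hx]
    have e2 : Finset.univ.filter (fun a => s a = a ∧ r a x) = {x} := by
      ext a; simp [r, hx]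
      rintro rfl; exact hx
    rw [e1, e2]; simp
  · have e1 : Finset.univ.filter (fun a => r a x) = {x, s x} := by
      ext a; simp [r]
    have e2 : Finset.univ.filter (fun a => s a = a ∧ r a x) = ∅ := by
      rw [Finset.filter_eq_empty_iff]
      rintro a - ⟨h1, rfl | rfl⟩
      · exact hx h1
      · rw [hs] at h1; exact hx h1.symm
    rw [e1, e2, Finset.card_pair (Ne.symm hx)]; simp

abbrev cok {B : Type*} [AddCommGroup B] (T : B →ₗ[ℤ] B) := B ⧸ LinearMap.range T

lemma cok_mk_eq {B : Type*} [AddCommGroup B] (T : B →ₗ[ℤ] B) (x y : B) :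
    ((Submodule.Quotient.mk x : cok T) = Submodule.Quotient.mk y) ↔ ∃ w, x = y + T w := by
  rw [Submodule.Quotient.eq, LinearMap.mem_range]
  constructor
  · rintro ⟨w, h⟩; exact ⟨w, by rw [h]; abel⟩
  · rintro ⟨w, h⟩; exact ⟨w, by rw [h]; abel⟩

lemma sol_le {B : Type*} [AddCommGroup B] (S T : B →ₗ[ℤ] B) (hS : Function.Injective S)
    (hc : ∀ x, S (T x) = T (S x)) [Finite (cok S)] (d : B) :
    Nat.card {q : cok T // ∃ x, q = Submodule.Quotient.mk x ∧ ∃ y, S x = d + T y} ≤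
    Nat.card {q : cok S // ∃ y, q = Submodule.Quotient.mk y ∧ ∃ x, T y = - d + S x} := by
  choose x hx y hy using fun q : {q : cok T // ∃ x, q = Submodule.Quotient.mk x ∧ ∃ y, S x = d + T y} => q.2
  refine Nat.card_le_card_of_injective (fun q => ⟨Submodule.Quotient.mk (y q), y q, rfl, x q, ?_⟩) ?_
  · rw [hy]; abel
  · intro q q' h
    have h' : (Submodule.Quotient.mk (y q) : cok S) = Submodule.Quotient.mk (y q') := congrArg Subtype.val h
    obtain ⟨w, hw⟩ := (cok_mk_eq S _ _).1 h'
    apply Subtype.ext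
    rw [hx q, hx q', cok_mk_eq]
    refine ⟨w, hS ?_⟩
    rw [map_add, hy, hy, hw, hc, map_add]
    abel

lemma sol_eq {B : Type*} [AddCommGroup B] (S T : B →ₗ[ℤ] B) (hS : Function.Injective S)
    (hT : Function.Injective T)
    (hc : ∀ x, S (T x) = T (S x)) [Finite (cok S)] [Finite (cok T)] (d : B) :
    Nat.card {q : cok T // ∃ x, q = Submodule.Quotient.mk x ∧ ∃ y, S x = d + T y} =
    Nat.card {q : cok S // ∃ y, q = Submodule.Quotient.mk y ∧ ∃ x, T y = - d + S x} := by
  apply le_antisymm (sol_le S T hS hc d)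
  have := sol_le T S hT (fun x => (hc x).symm) (-d)
  simpa only [neg_neg] using this

variable {n : ℕ}

lemma cok_card (T : (Fin n → ℤ) →ₗ[ℤ] (Fin n → ℤ)) (hT : Function.Injective T) :
    Nat.card (cok T) = (LinearMap.det T).natAbs := by
  rw [← Submodule.natAbs_det_equiv (LinearMap.range T) (LinearEquiv.ofInjective T hT)]
  rfl

lemma det_ne_of_inj (T : (Fin n → ℤ) →ₗ[ℤ] (Fin n → ℤ)) (hT : Function.Injective T) :
    LinearMap.det T ≠ 0 := by
  intro h
  rw [← LinearMap.det_toMatrix', ← Matrix.exists_mulVec_eq_zero_iff] at h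
  obtain ⟨v, hv, h⟩ := h
  rw [LinearMap.toMatrix'_mulVec] at h
  exact hv (hT (by rw [h, map_zero]))

lemma inj_of_finite_cok (T : (Fin n → ℤ) →ₗ[ℤ] (Fin n → ℤ)) [Finite (cok T)] :
    Function.Injective T := by
  have h : (LinearMap.range T).toAddSubgroup.index ≠ 0 := by
    have : Nat.card (cok T) ≠ 0 := Nat.card_pos.ne'
    exact this
  obtain ⟨e⟩ := Int.submodule_toAddSubgroup_index_ne_zero_iff.1 h
  have h2 : Function.Surjective (e.toLinearMap ∘ₗ T.rangeRestrict) := by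
    rw [LinearMap.coe_comp]
    exact e.surjective.comp T.surjective_rangeRestrict
  have h3 := IsNoetherian.injective_of_surjective_endomorphism _ h2
  intro x y hxy
  apply h3
  simp only [LinearMap.comp_apply]
  congr 1
  exact Subtype.ext hxy

lemma finite_cok_of_inj (T : (Fin n → ℤ) →ₗ[ℤ] (Fin n → ℤ)) (hT : Function.Injective T) :
    Finite (cok T) := by
  apply Nat.finite_of_card_ne_zero
  rw [cok_card T hT]
  simpa using det_ne_of_inj T hT

/-- multiplication by two -/
noncomputable def two (n : ℕ) : (Fin n → ℤ) →ₗ[ℤ] (Fin n → ℤ) := (2 : ℤ) • LinearMap.id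

lemma two_apply (x : Fin n → ℤ) : two n x = x + x := by
  simp [two, two_smul]

lemma two_inj : Function.Injective (two n) := by
  intro x y h
  rw [two_apply, two_apply] at h
  ext i
  have := congrFun h i
  simp only [Pi.add_apply] at this
  omega

instance : Finite (cok (two n)) := finite_cok_of_inj _ two_inj

/-- The relation on `ℤⁿ` -/
def rel (T : (Fin n → ℤ) →ₗ[ℤ] (Fin n → ℤ)) (d : Fin n → ℤ) (x x' : Fin n → ℤ) : Prop :=
  (∃ y, x = x' + T y) ∨ (∃ y, x = -x' + d + T y)

/-- The induced involution. -/
noncomputable def inv' (T : (Fin n → ℤ) →ₗ[ℤ] (Fin n → ℤ)) (d : Fin n → ℤ) (q : cok T) : cok T :=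
  -q + Submodule.Quotient.mk d

lemma inv'_mk (T : (Fin n → ℤ) →ₗ[ℤ] (Fin n → ℤ)) (d : Fin n → ℤ) (x : Fin n → ℤ) :
    inv' T d (Submodule.Quotient.mk x) = Submodule.Quotient.mk (-x + d) := rfl

lemma inv'_inv' (T : (Fin n → ℤ) →ₗ[ℤ] (Fin n → ℤ)) (d : Fin n → ℤ) (q : cok T) :
    inv' T d (inv' T d q) = q := by
  unfold inv'; abel

lemma rel_iff (T : (Fin n → ℤ) →ₗ[ℤ] (Fin n → ℤ)) (d : Fin n → ℤ) (x x' : Fin n → ℤ) :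
    rel T d x x' ↔ ((Submodule.Quotient.mk x : cok T) = Submodule.Quotient.mk x' ∨
      (Submodule.Quotient.mk x : cok T) = inv' T d (Submodule.Quotient.mk x')) := by
  rw [inv'_mk, cok_mk_eq, cok_mk_eq]; rfl

noncomputable def quotRelEquiv (T : (Fin n → ℤ) →ₗ[ℤ] (Fin n → ℤ)) (d : Fin n → ℤ) :
    Quot (rel T d) ≃ Quot (fun x y : cok T => x = y ∨ x = inv' T d y) where
  toFun := Quot.map (fun x => Submodule.Quotient.mk x) (fun x y h => (rel_iff T d x y).1 h)
  invFun := Quot.lift (fun q : cok T => Quot.mk _ (Quotient.out q)) (by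
    intro a b h
    apply Quot.sound
    rw [rel_iff]
    have ha : (Submodule.Quotient.mk (Quotient.out a) : cok T) = a := Quotient.out_eq a
    have hb : (Submodule.Quotient.mk (Quotient.out b) : cok T) = b := Quotient.out_eq b
    rw [ha, hb]; exact h)
  left_inv := by
    rintro ⟨x⟩
    apply Quot.sound
    rw [rel_iff]
    left
    exact Quotient.out_eq _
  right_inv := by
    rintro ⟨q⟩
    change Quot.mk _ _ = Quot.mk _ _
    congr 1
    exact Quotient.out_eq q

lemma inj_of_finite_rel (T : (Fin n → ℤ) →ₗ[ℤ] (Fin n → ℤ)) (d : Fin n → ℤ) (hf : Finite (Quot (rel T d))) :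
    Function.Injective T := by
  have h1 : Finite (Quot (fun x y : cok T => x = y ∨ x = inv' T d y)) :=
    Finite.of_equiv _ (quotRelEquiv T d)
  have : Finite (cok T) := by
    apply Finite.of_surjective (fun p : Quot (fun x y : cok T => x = y ∨ x = inv' T d y) × Bool =>
      if p.2 then Quot.out p.1 else inv' T d (Quot.out p.1))
    intro q
    have hr : Equivalence (fun x y : cok T => x = y ∨ x = inv' T d y) := by
      refine ⟨fun x => Or.inl rfl, ?_, ?_⟩
      · rintro x y (h | h)
        · exact Or.inl h.symm
        · right; rw [h, inv'_inv']
      · rintro x y z (rfl | rfl) (rfl | rfl)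
        · exact Or.inl rfl
        · exact Or.inr rfl
        · exact Or.inr rfl
        · left; rw [inv'_inv']
    have h2 := Quot.out_eq (Quot.mk (fun x y : cok T => x = y ∨ x = inv' T d y) q)
    rw [Quot.eq, hr.eqvGen_iff] at h2
    rcases h2 with h2 | h2
    · exact ⟨(_, true), by simpa using h2⟩
    · exact ⟨(Quot.mk _ q, false), by simp [h2, inv'_inv']⟩
  exact inj_of_finite_cok T

lemma rel_card (T : (Fin n → ℤ) →ₗ[ℤ] (Fin n → ℤ)) (d : Fin n → ℤ) (hf : Finite (Quot (rel T d))) :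
    2 * Nat.card (Quot (rel T d)) = (LinearMap.det T).natAbs +
      Nat.card {q : cok (two n) // ∃ y, q = Submodule.Quotient.mk y ∧ ∃ x, T y = - d + two n x} := by
  have hT := inj_of_finite_rel T d hf
  have := finite_cok_of_inj T hT
  rw [Nat.card_congr (quotRelEquiv T d), card_quot_involution _ (inv'_inv' T d), cok_card T hT,
    ← sol_eq (two n) T two_inj hT (fun x => by simp [two_apply])]
  congr 1
  apply Nat.card_congr
  apply Equiv.subtypeEquivRight
  intro q
  constructor
  · intro h
    obtain ⟨x, rfl⟩ := Submodule.Quotient.mk_surjective _ q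
    rw [inv'_mk, eq_comm, cok_mk_eq] at h
    obtain ⟨w, h⟩ := h
    exact ⟨x, rfl, w, by rw [two_apply]; nth_rw 1 [h]; abel⟩
  · rintro ⟨x, rfl, w, h⟩
    rw [inv'_mk, eq_comm, cok_mk_eq]
    rw [two_apply] at h
    refine ⟨w, ?_⟩
    calc x = -x + (x + x) := by abel
      _ = -x + d + T w := by rw [h]; abel
end PartC
section PartD
variable {n : ℕ}

/-- the nontrivial element of `ℤ/2` -/
abbrev tt' : Multiplicative (ZMod 2) := Multiplicative.ofAdd 1

lemma tt'_cases (e : Multiplicative (ZMod 2)) : e = 1 ∨ e = tt' := by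
  revert e; decide

lemma tt'_ne : tt' ≠ 1 := by decide

lemma tt'_mul : tt' * tt' = 1 := by decide

lemma tt'_inv : tt'⁻¹ = tt' := by decide

lemma negAct_tt' (x : Znm n) : negAct n tt' x = x⁻¹ := by
  change (negAut n ^ (1 : ZMod 2).val) x = x⁻¹
  rw [show (1 : ZMod 2).val = 1 from rfl, pow_one]
  rfl

/-- the elements of `Γₙ` -/
def el0 (x : Fin n → ℤ) : Gamma n := ⟨Multiplicative.ofAdd x, 1⟩
def el1 (x : Fin n → ℤ) : Gamma n := ⟨Multiplicative.ofAdd x, tt'⟩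

lemma el_cases (g : Gamma n) : (∃ x, g = el0 x) ∨ (∃ x, g = el1 x) := by
  obtain ⟨x, e⟩ := g
  rcases tt'_cases e with rfl | rfl
  · exact Or.inl ⟨x.toAdd, rfl⟩
  · exact Or.inr ⟨x.toAdd, rfl⟩

lemma el0_mul_el0 (x y : Fin n → ℤ) : el0 x * el0 y = el0 (x + y) := by
  ext1
  · simp [el0]
  · simp [el0]

lemma el0_mul_el1 (x y : Fin n → ℤ) : el0 x * el1 y = el1 (x + y) := by
  ext1
  · simp [el0, el1]
  · simp [el0, el1]

lemma el1_mul_el0 (x y : Fin n → ℤ) : el1 x * el0 y = el1 (x - y) := by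
  ext1
  · simp [el0, el1, negAct_tt', sub_eq_add_neg]
  · exact mul_one tt'

lemma el1_mul_el1 (x y : Fin n → ℤ) : el1 x * el1 y = el0 (x - y) := by
  ext1
  · simp [el0, el1, negAct_tt', sub_eq_add_neg]
  · exact tt'_mul

lemma el0_zero : (el0 0 : Gamma n) = 1 := rfl

lemma el0_inv (x : Fin n → ℤ) : (el0 x)⁻¹ = el0 (-x) := by
  rw [inv_eq_iff_mul_eq_one, el0_mul_el0, add_neg_cancel, el0_zero]

lemma el1_inv (x : Fin n → ℤ) : (el1 x)⁻¹ = el1 x := by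
  rw [inv_eq_iff_mul_eq_one, el1_mul_el1, sub_self, el0_zero]

lemma el0_inj {x y : Fin n → ℤ} : el0 x = el0 y ↔ x = y := by
  constructor
  · intro h; exact congrArg (fun g : Gamma n => g.left.toAdd) h
  · rintro rfl; rfl

lemma el1_inj {x y : Fin n → ℤ} : el1 x = el1 y ↔ x = y := by
  constructor
  · intro h; exact congrArg (fun g : Gamma n => g.left.toAdd) h
  · rintro rfl; rfl

lemma el0_ne_el1 (x y : Fin n → ℤ) : el0 x ≠ el1 y := by
  intro h
  exact tt'_ne (congrArg (fun g : Gamma n => g.right) h).symm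

/-- `φ` acts by `A` on the lattice and `x ↦ A x + d` on the other coset. -/
def HasData (φ : MulAut (Gamma n)) (A : Module.End ℤ (Fin n → ℤ)) (d : Fin n → ℤ) : Prop :=
  (∀ x, φ (el0 x) = el0 (A x)) ∧ ∀ x, φ (el1 x) = el1 (A x + d)

lemma add_self_eq_zero' {x : Fin n → ℤ} (h : x + x = 0) : x = 0 := by
  ext i
  have := congrFun h i
  simp at this
  simpa using this

lemma exists_data (φ : MulAut (Gamma n)) : ∃ A d, HasData φ A d := by
  have h0 : ∀ x, ∃ y, φ (el0 x) = el0 y := by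
    intro x
    rcases el_cases (φ (el0 x)) with h | ⟨y, h⟩
    · exact h
    · exfalso
      have h1 : φ (el0 x * el0 x) = 1 := by
        rw [map_mul, h, el1_mul_el1, sub_self, el0_zero]
      rw [el0_mul_el0, EmbeddingLike.map_eq_one_iff, ← el0_zero, el0_inj] at h1
      rw [add_self_eq_zero' h1, el0_zero, map_one, ← el0_zero] at h
      exact el0_ne_el1 _ _ h
  have h1 : ∃ d, φ (el1 0) = el1 d := by
    rcases el_cases (φ (el1 0)) with ⟨y, h⟩ | h
    · exfalso
      have h1 : φ (el1 0 * el1 0) = el0 (y + y) := by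
        rw [map_mul, h, el0_mul_el0]
      rw [el1_mul_el1, sub_self, el0_zero, map_one, ← el0_zero, el0_inj] at h1
      rw [add_self_eq_zero' h1.symm, el0_zero, EmbeddingLike.map_eq_one_iff, ← el0_zero] at h
      exact el0_ne_el1 _ _ h.symm
    · exact h
  choose A hA using h0
  obtain ⟨d, hd⟩ := h1
  let A' : (Fin n → ℤ) →+ (Fin n → ℤ) := AddMonoidHom.mk' A (by
    intro x y
    rw [← el0_inj, ← hA, ← el0_mul_el0, map_mul, hA, hA, el0_mul_el0])
  refine ⟨A'.toIntLinearMap, d, hA, ?_⟩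
  intro x
  have : el1 x = el0 x * el1 0 := by rw [el0_mul_el1, add_zero]
  rw [this, map_mul, hA, hd, el0_mul_el1]
  rfl

lemma tc_00 {φ : MulAut (Gamma n)} {A d} (h : HasData φ A d) (x x' : Fin n → ℤ) :
    twistedConj (φ : Gamma n →* Gamma n) (el0 x) (el0 x') ↔ rel (1 - A) (-d) x x' := by
  constructor
  · rintro ⟨g, hg⟩
    rcases el_cases g with ⟨y, rfl⟩ | ⟨y, rfl⟩
    · left
      refine ⟨y, ?_⟩
      simp only [MonoidHom.coe_coe, h.1, el0_mul_el0, el0_inv, el0_inj] at hg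
      rw [hg, LinearMap.sub_apply, Module.End.one_apply]; abel
    · right
      refine ⟨y, ?_⟩
      simp only [MonoidHom.coe_coe, h.2, el1_mul_el0, el1_mul_el1, el1_inv, el0_inj] at hg
      rw [hg, LinearMap.sub_apply, Module.End.one_apply]; abel
  · rintro (⟨y, hy⟩ | ⟨y, hy⟩)
    · refine ⟨el0 y, ?_⟩
      simp only [MonoidHom.coe_coe, h.1, el0_mul_el0, el0_inv, el0_inj]
      rw [hy, LinearMap.sub_apply, Module.End.one_apply]; abel
    · refine ⟨el1 y, ?_⟩
      simp only [MonoidHom.coe_coe, h.2, el1_mul_el0, el1_mul_el1, el1_inv, el0_inj]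
      rw [hy, LinearMap.sub_apply, Module.End.one_apply]; abel

lemma tc_11 {φ : MulAut (Gamma n)} {A d} (h : HasData φ A d) (x x' : Fin n → ℤ) :
    twistedConj (φ : Gamma n →* Gamma n) (el1 x) (el1 x') ↔ rel (1 + A) d x x' := by
  constructor
  · rintro ⟨g, hg⟩
    rcases el_cases g with ⟨y, rfl⟩ | ⟨y, rfl⟩
    · left
      refine ⟨y, ?_⟩
      simp only [MonoidHom.coe_coe, h.1, el0_mul_el1, el1_mul_el0, el0_inv, el1_inj] at hg
      rw [hg, LinearMap.add_apply, Module.End.one_apply]; abel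
    · right
      refine ⟨y, ?_⟩
      simp only [MonoidHom.coe_coe, h.2, el0_mul_el1, el1_mul_el1, el1_inv, el1_inj] at hg
      rw [hg, LinearMap.add_apply, Module.End.one_apply]; abel
  · rintro (⟨y, hy⟩ | ⟨y, hy⟩)
    · refine ⟨el0 y, ?_⟩
      simp only [MonoidHom.coe_coe, h.1, el0_mul_el1, el1_mul_el0, el0_inv, el1_inj]
      rw [hy, LinearMap.add_apply, Module.End.one_apply]; abel
    · refine ⟨el1 y, ?_⟩
      simp only [MonoidHom.coe_coe, h.2, el0_mul_el1, el1_mul_el1, el1_inv, el1_inj]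
      rw [hy, LinearMap.add_apply, Module.End.one_apply]; abel

lemma tc_01 {φ : MulAut (Gamma n)} {A d} (h : HasData φ A d) (x x' : Fin n → ℤ) :
    ¬ twistedConj (φ : Gamma n →* Gamma n) (el0 x) (el1 x') := by
  rintro ⟨g, hg⟩
  rcases el_cases g with ⟨y, rfl⟩ | ⟨y, rfl⟩
  · simp only [MonoidHom.coe_coe, h.1, el0_mul_el1, el1_mul_el0, el0_inv] at hg
    exact el0_ne_el1 _ _ hg
  · simp only [MonoidHom.coe_coe, h.2, el0_mul_el1, el1_mul_el1, el1_inv] at hg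
    exact el0_ne_el1 _ _ hg

lemma tc_10 {φ : MulAut (Gamma n)} {A d} (h : HasData φ A d) (x x' : Fin n → ℤ) :
    ¬ twistedConj (φ : Gamma n →* Gamma n) (el1 x) (el0 x') := by
  rintro ⟨g, hg⟩
  rcases el_cases g with ⟨y, rfl⟩ | ⟨y, rfl⟩
  · simp only [MonoidHom.coe_coe, h.1, el0_mul_el0, el0_inv] at hg
    exact el0_ne_el1 _ _ hg.symm
  · simp only [MonoidHom.coe_coe, h.2, el1_mul_el0, el1_mul_el1, el1_inv] at hg
    exact el0_ne_el1 _ _ hg.symm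

/-- Decomposition of the set of twisted conjugacy classes. -/
lemma quot_equiv {φ : MulAut (Gamma n)} {A d} (h : HasData φ A d) :
    Nonempty ((Quot (rel (1 - A) (-d)) ⊕ Quot (rel (1 + A) d)) ≃
      Quot (twistedConj (φ : Gamma n →* Gamma n))) := by
  classical
  let F : Gamma n → Quot (rel (1 - A) (-d)) ⊕ Quot (rel (1 + A) d) := fun g =>
    if g.right = 1 then Sum.inl (Quot.mk _ g.left.toAdd) else Sum.inr (Quot.mk _ g.left.toAdd)
  have F0 : ∀ x, F (el0 x) = Sum.inl (Quot.mk _ x) := fun x => if_pos rfl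
  have F1 : ∀ x, F (el1 x) = Sum.inr (Quot.mk _ x) := fun x => if_neg tt'_ne
  refine ⟨⟨Sum.elim (Quot.map el0 (fun x y hxy => (tc_00 h x y).2 hxy))
      (Quot.map el1 (fun x y hxy => (tc_11 h x y).2 hxy)),
    Quot.lift F ?_, ?_, ?_⟩⟩
  · intro a b hab
    rcases el_cases a with ⟨x, rfl⟩ | ⟨x, rfl⟩ <;> rcases el_cases b with ⟨y, rfl⟩ | ⟨y, rfl⟩
    · rw [F0, F0, Quot.sound ((tc_00 h _ _).1 hab)]
    · exact absurd hab (tc_01 h _ _)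
    · exact absurd hab (tc_10 h _ _)
    · rw [F1, F1, Quot.sound ((tc_11 h _ _).1 hab)]
  · rintro (q | q)
    · obtain ⟨x, rfl⟩ := Quot.mk_surjective q
      exact F0 x
    · obtain ⟨x, rfl⟩ := Quot.mk_surjective q
      exact F1 x
  · rintro ⟨g⟩
    rcases el_cases g with ⟨x, rfl⟩ | ⟨x, rfl⟩
    · change Sum.elim _ _ (F (el0 x)) = _
      rw [F0]; rfl
    · change Sum.elim _ _ (F (el1 x)) = _
      rw [F1]; rfl

/-- The induced affine map mod 2. -/
noncomputable def aff (A : Module.End ℤ (Fin n → ℤ)) (d : Fin n → ℤ) (q : cok (two n)) : cok (two n) :=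
  Submodule.mapQ (LinearMap.range (two n)) (LinearMap.range (two n)) A (by
    rintro _ ⟨x, rfl⟩
    exact ⟨A x, by simp [two_apply]⟩) q + Submodule.Quotient.mk d

lemma aff_mk (A : Module.End ℤ (Fin n → ℤ)) (d y : Fin n → ℤ) :
    aff A d (Submodule.Quotient.mk y) = Submodule.Quotient.mk (A y + d) := rfl

lemma data_card {φ : MulAut (Gamma n)} {A d} (h : HasData φ A d)
    (hf : Finite (Quot (twistedConj (φ : Gamma n →* Gamma n)))) :
    LinearMap.det (1 - A) ≠ 0 ∧
    2 * reidemeisterNumber (φ : Gamma n →* Gamma n) = (LinearMap.det (1 - A)).natAbs +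
      (LinearMap.det (1 + A)).natAbs + 2 * Nat.card {q : cok (two n) // aff A d q = q} := by
  obtain ⟨e⟩ := quot_equiv h
  have hs : Finite (Quot (rel (1 - A) (-d)) ⊕ Quot (rel (1 + A) d)) := Finite.of_equiv _ e.symm
  have h0 : Finite (Quot (rel (1 - A) (-d))) := Finite.sum_left (Quot (rel (1 + A) d))
  have h1 : Finite (Quot (rel (1 + A) d)) := Finite.sum_right (Quot (rel (1 - A) (-d)))
  refine ⟨det_ne_of_inj _ (inj_of_finite_rel _ _ h0), ?_⟩
  rw [reidemeisterNumber, ← Nat.card_congr e, Nat.card_sum, mul_add, rel_card _ _ h0, rel_card _ _ h1]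
  have e0 : Nat.card {q : cok (two n) // ∃ y, q = Submodule.Quotient.mk y ∧
      ∃ x, (1 - A) y = - (-d) + two n x} = Nat.card {q : cok (two n) // aff A d q = q} := by
    apply Nat.card_congr
    apply Equiv.subtypeEquivRight
    intro q
    constructor
    · rintro ⟨y, rfl, x, hx⟩
      rw [aff_mk, eq_comm, cok_mk_eq]
      rw [LinearMap.sub_apply, Module.End.one_apply, sub_eq_iff_eq_add] at hx
      refine ⟨x, hx.trans ?_⟩
      abel
    · intro hq
      obtain ⟨y, rfl⟩ := Submodule.Quotient.mk_surjective _ q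
      rw [aff_mk, eq_comm, cok_mk_eq] at hq
      obtain ⟨x, hx⟩ := hq
      refine ⟨y, rfl, x, ?_⟩
      rw [LinearMap.sub_apply, Module.End.one_apply, sub_eq_iff_eq_add]
      nth_rw 1 [hx]; abel
  have e1 : Nat.card {q : cok (two n) // ∃ y, q = Submodule.Quotient.mk y ∧
      ∃ x, (1 + A) y = - d + two n x} = Nat.card {q : cok (two n) // aff A d q = q} := by
    apply Nat.card_congr
    apply Equiv.subtypeEquivRight
    intro q
    constructor
    · rintro ⟨y, rfl, x, hx⟩
      rw [aff_mk, cok_mk_eq]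
      rw [LinearMap.add_apply, Module.End.one_apply] at hx
      refine ⟨x - y, ?_⟩
      rw [map_sub, two_apply y]
      have : two n x = y + A y + d := by rw [hx]; abel
      rw [this]; abel
    · intro hq
      obtain ⟨y, rfl⟩ := Submodule.Quotient.mk_surjective _ q
      rw [aff_mk, cok_mk_eq] at hq
      obtain ⟨x, hx⟩ := hq
      refine ⟨y, rfl, x + y, ?_⟩
      rw [LinearMap.add_apply, Module.End.one_apply, map_add, two_apply y]
      rw [eq_sub_of_add_eq hx]; abel
  rw [e0, e1]
  ring

lemma data_pow {φ : MulAut (Gamma n)} {A d} (h : HasData φ A d) (k : ℕ) :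
    ∃ e, HasData (φ ^ k) (A ^ k) e ∧ ∀ q, (aff A d)^[k] q = aff (A ^ k) e q := by
  induction k with
  | zero =>
    refine ⟨0, ⟨fun x => rfl, fun x => by simp⟩, ?_⟩
    intro q
    obtain ⟨y, rfl⟩ := Submodule.Quotient.mk_surjective _ q
    rw [aff_mk]
    simp
  | succ k ih =>
    obtain ⟨e, he, hq⟩ := ih
    refine ⟨A e + d, ⟨fun x => ?_, fun x => ?_⟩, fun q => ?_⟩
    · rw [pow_succ', pow_succ', MulAut.mul_apply, he.1, h.1]; rfl
    · rw [pow_succ', pow_succ', MulAut.mul_apply, he.2, h.2, map_add, add_assoc]; rfl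
    · rw [Function.iterate_succ_apply', hq]
      obtain ⟨y, rfl⟩ := Submodule.Quotient.mk_surjective _ q
      rw [aff_mk, aff_mk, aff_mk, map_add, add_assoc, pow_succ']; rfl

lemma reid_formula (φ : MulAut (Gamma n))
    (hfin : ∀ k : ℕ, 0 < k →
      Finite (Quot (twistedConj ((φ ^ k : MulAut (Gamma n)) : Gamma n →* Gamma n)))) :
    ∃ (a l : ℕ) (μ : Fin a → ℂ) (c : Fin l → ℕ), ∀ k : ℕ, 0 < k →
      (reidemeisterNumber ((φ ^ k : MulAut (Gamma n)) : Gamma n →* Gamma n) : ℂ) =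
        ∑ i, μ i ^ k + ∑ i : Fin l, (if (i : ℕ) + 1 ∣ k then (((i : ℕ) : ℂ) + 1) * c i else 0) := by
  obtain ⟨A, d, h⟩ := exists_data φ
  have hk : ∀ k : ℕ, 0 < k → LinearMap.det (1 - A ^ k) ≠ 0 ∧
      2 * reidemeisterNumber ((φ ^ k : MulAut (Gamma n)) : Gamma n →* Gamma n) = (LinearMap.det (1 - A ^ k)).natAbs +
      (LinearMap.det (1 + A ^ k)).natAbs + 2 * Nat.card {q : cok (two n) // (aff A d)^[k] q = q} := by
    intro k hk
    obtain ⟨e, he, hq⟩ := data_pow h k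
    simp only [hq]
    exact data_card he (hfin k hk)
  set M := LinearMap.toMatrixAlgEquiv' A with hM
  have hd1 : ∀ k, LinearMap.det (1 - A ^ k) = (1 - M ^ k).det := by
    intro k
    rw [← LinearMap.det_toMatrix']
    change (LinearMap.toMatrixAlgEquiv' (1 - A ^ k)).det = _
    rw [map_sub, map_pow, map_one]
  have hd2 : ∀ k, LinearMap.det (1 + A ^ k) = (1 + M ^ k).det := by
    intro k
    rw [← LinearMap.det_toMatrix']
    change (LinearMap.toMatrixAlgEquiv' (1 + A ^ k)).det = _
    rw [map_add, map_pow, map_one]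
  simp only [hd1, hd2] at hk
  obtain ⟨a, μ, hμ⟩ := eigen_sum M (fun k h => (hk k h).1)
  obtain ⟨l, c, hc⟩ := fix_count (aff A d)
  refine ⟨a, l, μ, c, fun k hk0 => ?_⟩
  have h1 := (hk k hk0).2
  rw [hc k hk0] at h1
  have h2 := hμ k hk0
  have h3 : (2 : ℂ) * (reidemeisterNumber ((φ ^ k : MulAut (Gamma n)) : Gamma n →* Gamma n) : ℂ) =
      ((|(1 - M ^ k).det| : ℤ) : ℂ) + ((|(1 + M ^ k).det| : ℤ) : ℂ) +
      2 * ∑ i : Fin l, (if (i : ℕ) + 1 ∣ k then (((i : ℕ) : ℂ) + 1) * c i else 0) := by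
    rw [← Int.natCast_natAbs, ← Int.natCast_natAbs, Int.cast_natCast, Int.cast_natCast]
    have := congrArg (fun m : ℕ => (m : ℂ)) h1
    simp only [Nat.cast_add, Nat.cast_mul, Nat.cast_sum, Nat.cast_ite, Nat.cast_ofNat, Nat.cast_one, Nat.cast_zero] at this
    exact this
  rw [h2, ← mul_add] at h3
  exact mul_left_cancel₀ two_ne_zero h3
end PartD
section PartE

lemma hasSum_log_shift {w : ℂ} (hw : ‖w‖ < 1) :
    HasSum (fun k : ℕ => w ^ (k + 1) / ((k : ℂ) + 1)) (-Complex.log (1 - w)) := by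
  have := (hasSum_nat_add_iff' 1).2 (Complex.hasSum_taylorSeries_neg_log hw)
  simpa using this

lemma hasSum_cyc {z : ℂ} (hz : ‖z‖ < 1) (m : ℕ) (hm : 0 < m) :
    HasSum (fun k : ℕ => if m ∣ k + 1 then (m : ℂ) * z ^ (k + 1) / ((k : ℂ) + 1) else 0)
      (-Complex.log (1 - z ^ m)) := by
  have h0 : ‖z ^ m‖ < 1 := by
    rw [norm_pow]; exact pow_lt_one₀ (norm_nonneg _) hz hm.ne'
  have h1 : HasSum (fun k : ℕ => if m ∣ k then (m : ℂ) * z ^ k / (k : ℂ) else 0)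
      (-Complex.log (1 - z ^ m)) := by
    have hinj : Function.Injective (fun j : ℕ => m * j) := fun a b h => Nat.eq_of_mul_eq_mul_left hm h
    rw [← hinj.hasSum_iff]
    · convert Complex.hasSum_taylorSeries_neg_log h0 using 1
      ext j
      simp only [Function.comp_apply, dvd_mul_right, if_true]
      have hm' : (m : ℂ) ≠ 0 := by exact_mod_cast hm.ne'
      push_cast
      rw [mul_div_mul_left _ _ hm', pow_mul]
    · intro x hx
      rw [if_neg]
      rintro ⟨j, rfl⟩
      exact hx ⟨j, rfl⟩
  have := (hasSum_nat_add_iff' 1).2 h1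
  simpa using this

lemma zeta_sum {a l : ℕ} (μ : Fin a → ℂ) (c : Fin l → ℕ) (R : ℕ → ℂ)
    (hR : ∀ k : ℕ, R k = ∑ i, μ i ^ (k + 1) +
      ∑ i : Fin l, (if (i : ℕ) + 1 ∣ k + 1 then (((i : ℕ) : ℂ) + 1) * c i else 0))
    (z : ℂ) (hz : ‖z‖ < 1) (hμ : ∀ i, ‖μ i * z‖ < 1) :
    ∃ s : ℂ, HasSum (fun k : ℕ => R k * z ^ (k + 1) / ((k : ℂ) + 1)) s ∧
      Complex.exp s * ((∏ i, (1 - μ i * z)) * ∏ i : Fin l, (1 - z ^ ((i : ℕ) + 1)) ^ (c i)) = 1 := by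
  have hne : ∀ w : ℂ, ‖w‖ < 1 → 1 - w ≠ 0 := by
    intro w hw h
    rw [← sub_eq_zero.1 h] at hw
    simp at hw
  have hzm : ∀ i : Fin l, ‖z ^ ((i : ℕ) + 1)‖ < 1 := by
    intro i
    rw [norm_pow]; exact pow_lt_one₀ (norm_nonneg _) hz (Nat.succ_ne_zero _)
  refine ⟨∑ i, (-Complex.log (1 - μ i * z)) + ∑ i : Fin l, (c i : ℂ) * (-Complex.log (1 - z ^ ((i : ℕ) + 1))), ?_, ?_⟩
  · have h1 := hasSum_sum (s := Finset.univ) (fun i _ => hasSum_log_shift (hμ i))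
    have h2 := hasSum_sum (s := (Finset.univ : Finset (Fin l)))
      (fun i _ => (hasSum_cyc hz ((i : ℕ) + 1) (Nat.succ_pos _)).mul_left (c i : ℂ))
    convert h1.add h2 using 1
    ext k
    rw [hR, add_mul, add_div, Finset.sum_mul, Finset.sum_mul, Finset.sum_div, Finset.sum_div]
    congr 1
    · refine Finset.sum_congr rfl fun i _ => ?_
      rw [mul_pow]
    · refine Finset.sum_congr rfl fun i _ => ?_
      split_ifs
      · push_cast; ring
      · simp
  · rw [Complex.exp_add, Complex.exp_sum, Complex.exp_sum, mul_mul_mul_comm, ← Finset.prod_mul_distrib,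
      ← Finset.prod_mul_distrib]
    have e1 : ∀ i, Complex.exp (-Complex.log (1 - μ i * z)) * (1 - μ i * z) = 1 := by
      intro i
      rw [Complex.exp_neg, Complex.exp_log (hne _ (hμ i)), inv_mul_cancel₀ (hne _ (hμ i))]
    have e2 : ∀ i : Fin l, Complex.exp ((c i : ℂ) * (-Complex.log (1 - z ^ ((i : ℕ) + 1)))) *
        (1 - z ^ ((i : ℕ) + 1)) ^ (c i) = 1 := by
      intro i
      rw [Complex.exp_nat_mul, ← mul_pow, Complex.exp_neg, Complex.exp_log (hne _ (hzm i)),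
        inv_mul_cancel₀ (hne _ (hzm i)), one_pow]
    simp only [e1, e2, Finset.prod_const_one, mul_one]

lemma zeta_div {a l : ℕ} (μ : Fin a → ℂ) (c : Fin l → ℕ) (R : ℕ → ℂ)
    (hR : ∀ k : ℕ, R k = ∑ i, μ i ^ (k + 1) +
      ∑ i : Fin l, (if (i : ℕ) + 1 ∣ k + 1 then (((i : ℕ) : ℂ) + 1) * c i else 0))
    (i₀ : Fin a) (h1 : 1 < ‖μ i₀‖) (hmax : ∀ i, ‖μ i‖ ≤ ‖μ i₀‖) (z : ℂ) (hz : ‖μ i₀‖⁻¹ < ‖z‖) :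
    ¬ Summable (fun k : ℕ => R k * z ^ (k + 1) / ((k : ℂ) + 1)) := by
  intro hs
  have h0 : μ i₀ ≠ 0 := by
    intro h; rw [h, norm_zero] at h1; linarith
  set w : ℂ := (μ i₀)⁻¹ with hw
  have hwz : ‖w‖ < ‖z‖ := by rw [hw, norm_inv]; exact hz
  let g : ℝ → ℂ := fun t => ∑' k : ℕ, R k * ((t : ℂ) * w) ^ (k + 1) / ((k : ℂ) + 1)
  have hg : ContinuousOn g (Set.Icc 0 1) := by
    apply continuousOn_tsum (u := fun k => ‖R k * z ^ (k + 1) / ((k : ℂ) + 1)‖)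
    · intro k
      apply Continuous.continuousOn
      fun_prop
    · exact hs.norm
    · intro k t ht
      rw [norm_div, norm_div, norm_mul, norm_mul, norm_pow, norm_pow, norm_mul]
      gcongr
      rw [Complex.norm_real, Real.norm_eq_abs, abs_of_nonneg ht.1]
      calc t * ‖w‖ ≤ 1 * ‖w‖ := by gcongr; exact ht.2
        _ ≤ ‖z‖ := by rw [one_mul]; exact hwz.le
  let P : ℝ → ℂ := fun t => (∏ i, (1 - μ i * ((t : ℂ) * w))) *
    ∏ i : Fin l, (1 - ((t : ℂ) * w) ^ ((i : ℕ) + 1)) ^ (c i)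
  have hP : Continuous P := by fun_prop
  have hEq : Set.EqOn (fun t => Complex.exp (g t) * P t) (fun _ => 1) (Set.Ico 0 1) := by
    intro t ht
    have htw : ‖(t : ℂ) * w‖ = t * ‖μ i₀‖⁻¹ := by
      rw [norm_mul, Complex.norm_real, Real.norm_eq_abs, abs_of_nonneg ht.1, hw, norm_inv]
    have hpos : 0 < ‖μ i₀‖ := by linarith
    have hμ : ∀ i, ‖μ i * ((t : ℂ) * w)‖ < 1 := by
      intro i
      rw [norm_mul, htw]
      calc ‖μ i‖ * (t * ‖μ i₀‖⁻¹) ≤ ‖μ i₀‖ * (t * ‖μ i₀‖⁻¹) := by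
            gcongr
            · exact mul_nonneg ht.1 (inv_nonneg.2 hpos.le)
            · exact hmax i
        _ = t := by field_simp
        _ < 1 := ht.2
    have hz1 : ‖(t : ℂ) * w‖ < 1 := by
      rw [htw]
      calc t * ‖μ i₀‖⁻¹ ≤ t * 1 := by
            gcongr
            · exact ht.1
            · exact inv_le_one_of_one_le₀ h1.le
        _ < 1 := by rw [mul_one]; exact ht.2
    obtain ⟨s, hs, he⟩ := zeta_sum μ c R hR _ hz1 hμ
    change Complex.exp (g t) * P t = 1
    have : g t = s := hs.tsum_eq
    rw [this]
    exact he
  have hcl := Set.EqOn.of_subset_closure hEq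
    ((Complex.continuous_exp.comp_continuousOn hg).mul hP.continuousOn) continuousOn_const
    Set.Ico_subset_Icc_self (by rw [closure_Ico (by norm_num)])
  have h2 := hcl (Set.right_mem_Icc.2 zero_le_one)
  have hP1 : P 1 = 0 := by
    change (∏ i, (1 - μ i * (((1 : ℝ) : ℂ) * w))) * _ = 0
    rw [Finset.prod_eq_zero (Finset.mem_univ i₀), zero_mul]
    rw [Complex.ofReal_one, one_mul, hw, mul_inv_cancel₀ h0, sub_self]
  simp [hP1] at h2

lemma zeta_div_one (R : ℕ → ℂ) (hR : ∀ k, 1 ≤ ‖R k‖) (z : ℂ) (hz : 1 < ‖z‖) :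
    ¬ Summable (fun k : ℕ => R k * z ^ (k + 1) / ((k : ℂ) + 1)) := by
  intro hs
  apply Real.not_summable_one_div_natCast
  refine (summable_nat_add_iff (G := ℝ) (f := fun n : ℕ => 1 / (n : ℝ)) 1).1 ?_
  refine Summable.of_nonneg_of_le (fun k => by positivity) (fun k => ?_) hs.norm
  rw [norm_div, norm_mul, norm_pow]
  have : ‖(k : ℂ) + 1‖ = ((k + 1 : ℕ) : ℝ) := by
    rw [← Nat.cast_succ, Complex.norm_natCast]
  rw [this]
  gcongr
  have := one_le_pow₀ hz.le (n := k + 1)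
  nlinarith [hR k]

end PartE
/-- for an automorphism `φ` of `Γₙ = ℤⁿ ⋊ ℤ/2ℤ` (`n ≥ 2`) with all `R(φᵏ)`
finite, there are `μᵢ, νᵢ ∈ ℂ` and `cᵢ ∈ ℕ` such that, with
`r = 1 / max{1, |μ₁|, …, |μ_a|, |ν₁|, …, |ν_b|}`, the power series `∑_{k≥1} R(φᵏ) zᵏ/k` has
radius of convergence `r` (it converges for `‖z‖ < r` and diverges for `‖z‖ > r`) and for
`‖z‖ < r` the exponential of its sum is
`∏(1-νᵢz) / (∏(1-μᵢz) ∏(1-zⁱ)^{cᵢ})`. -/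
theorem stmt16 (n : ℕ) (hn : 2 ≤ n) (φ : MulAut (Gamma n))
    (hfin : ∀ k : ℕ, 0 < k →
      Finite (Quot (twistedConj ((φ ^ k : MulAut (Gamma n)) : Gamma n →* Gamma n)))) :
    ∃ (a b l : ℕ) (μ : Fin a → ℂ) (ν : Fin b → ℂ) (c : Fin l → ℕ),
      ∀ r : ℝ,
        r = ((max 1 (max (Finset.univ.sup fun i : Fin a => ‖μ i‖₊)
              (Finset.univ.sup fun i : Fin b => ‖ν i‖₊)) : ℝ≥0) : ℝ)⁻¹ →
        (∀ z : ℂ, ‖z‖ < r →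
          ∃ s : ℂ,
            HasSum (fun k : ℕ =>
              (reidemeisterNumber ((φ ^ (k + 1) : MulAut (Gamma n)) : Gamma n →* Gamma n) : ℂ)
                * z ^ (k + 1) / (k + 1)) s ∧
            Complex.exp s = (∏ i, (1 - ν i * z)) /
              ((∏ i, (1 - μ i * z)) * ∏ i : Fin l, (1 - z ^ ((i : ℕ) + 1)) ^ (c i))) ∧
        (∀ z : ℂ, r < ‖z‖ →
          ¬ Summable (fun k : ℕ =>
            (reidemeisterNumber ((φ ^ (k + 1) : MulAut (Gamma n)) : Gamma n →* Gamma n) : ℂ)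
              * z ^ (k + 1) / (k + 1))) := by
  obtain ⟨a, l, μ, c, hR⟩ := reid_formula φ hfin
  refine ⟨a, 0, l, μ, Fin.elim0, c, ?_⟩
  intro r hr
  set R : ℕ → ℂ := fun k =>
    (reidemeisterNumber ((φ ^ (k + 1) : MulAut (Gamma n)) : Gamma n →* Gamma n) : ℂ) with hRdef
  have hR' : ∀ k : ℕ, R k = ∑ i, μ i ^ (k + 1) +
      ∑ i : Fin l, (if (i : ℕ) + 1 ∣ k + 1 then (((i : ℕ) : ℂ) + 1) * c i else 0) :=
    fun k => hR (k + 1) (Nat.succ_pos k)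
  have hR1 : ∀ k, 1 ≤ ‖R k‖ := by
    intro k
    have := hfin (k + 1) (Nat.succ_pos k)
    have h2 : 0 < reidemeisterNumber ((φ ^ (k + 1) : MulAut (Gamma n)) : Gamma n →* Gamma n) := by
      have : Nonempty (Quot (twistedConj ((φ ^ (k + 1) : MulAut (Gamma n)) : Gamma n →* Gamma n))) :=
        ⟨Quot.mk _ 1⟩
      exact Nat.card_pos
    rw [hRdef]
    simp only [Complex.norm_natCast]
    exact_mod_cast h2
  set S : ℝ≥0 := Finset.univ.sup fun i : Fin a => ‖μ i‖₊ with hS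
  have hsup0 : (Finset.univ.sup fun i : Fin 0 => ‖(Fin.elim0 i : ℂ)‖₊) = 0 := by simp
  rw [hsup0, max_eq_left (show (0 : ℝ≥0) ≤ S from bot_le)] at hr
  have hle : ∀ i, ‖μ i‖ ≤ (S : ℝ) := by
    intro i
    have : ‖μ i‖₊ ≤ S := Finset.le_sup (f := fun i : Fin a => ‖μ i‖₊) (Finset.mem_univ i)
    exact_mod_cast this
  have hMS : (S : ℝ) ≤ ((max 1 S : ℝ≥0) : ℝ) := by exact_mod_cast le_max_right 1 S
  have hM1 : 1 ≤ ((max 1 S : ℝ≥0) : ℝ) := by exact_mod_cast le_max_left 1 S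
  constructor
  · intro z hz
    have hzM : ‖z‖ * ((max 1 S : ℝ≥0) : ℝ) < 1 := by
      rw [hr] at hz
      rwa [← lt_div_iff₀ (by linarith), one_div]
    have hz1 : ‖z‖ < 1 := by nlinarith [norm_nonneg z]
    have hμ : ∀ i, ‖μ i * z‖ < 1 := by
      intro i
      rw [norm_mul]
      nlinarith [norm_nonneg z, hle i]
    obtain ⟨s, hs, he⟩ := zeta_sum μ c R hR' z hz1 hμ
    refine ⟨s, hs, ?_⟩
    rw [Finset.univ_eq_empty, Finset.prod_empty]
    exact eq_one_div_of_mul_eq_one_left he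
  · intro z hz
    by_cases h : S ≤ 1
    · rw [max_eq_left h] at hr
      refine zeta_div_one R hR1 z ?_
      rw [hr] at hz
      simpa using hz
    · push Not at h
      rw [max_eq_right h.le] at hr
      have hne : (Finset.univ : Finset (Fin a)).Nonempty := by
        by_contra hne
        rw [Finset.not_nonempty_iff_eq_empty] at hne
        rw [hS, hne, Finset.sup_empty] at h
        exact absurd h (by simp)
      obtain ⟨i₀, -, hi⟩ := Finset.exists_mem_eq_sup _ hne (fun i : Fin a => ‖μ i‖₊)
      have hSi : (S : ℝ) = ‖μ i₀‖ := by rw [hS, hi]; rfl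
      refine zeta_div μ c R hR' i₀ ?_ ?_ z ?_
      · rw [← hSi]; exact_mod_cast h
      · rw [← hSi]; exact hle
      · rw [← hSi, ← hr]; exact hz
end
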